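/- arXiv:math/9804020 — 4 statements merged into one kernel-verified Lean document; each statement's English description precedes it below -/
import Mathlib

section
/- Let D be a diagram and let W be a braiding of D on m = b(D) strands (a minimum braid index representative). Then W is related, by a finite sequence of commutation moves and cyclic permutation moves, to a chord word of the form A(i_1,j_1)^{w_1}...A(i_k,j_k)^{w_k} (the r-th generator repeated w_r ≥ 1 times consecutively) such that the chord word W_a = A(i_1,j_1)...A(i_k,j_k) is a braiding of an amalgamated diagram E and the blow-up of the standard name of W_a with weights w_1,...,w_k is a name of D. -/
/-- A chord word on `m` strands: a list of generators `A(i,j)` recorded as pairs `(i,j)`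
with `1 ≤ i < j ≤ m`. -/
def IsChordWord (m : ℕ) (W : List (ℕ × ℕ)) : Prop :=
  ∀ p ∈ W, 1 ≤ p.1 ∧ p.1 < p.2 ∧ p.2 ≤ m

/-- The standard name read from a chord word `W` on `m` strands: concatenate, for each
strand `s = 1, …, m`, the increasing enumeration of the (1-based) indices `r` of the
generators of `W` having `s` as an endpoint. -/
def standardName (m : ℕ) (W : List (ℕ × ℕ)) : List ℕ :=
  (List.range m).flatMap fun s =>
    ((List.range W.length).filter
      (fun r => decide ((W.getD r (0, 0)).1 = s + 1 ∨ (W.getD r (0, 0)).2 = s + 1))).map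
      (· + 1)

/-- `N` is a name of an `n`-diagram: a list of length `2n` over `{1, …, n}` in which
every label occurs exactly twice. -/
def IsName (n : ℕ) (N : List ℕ) : Prop :=
  N.length = 2 * n ∧ ∀ r, 1 ≤ r → r ≤ n → N.count r = 2

/-- Two names represent the same `n`-diagram: one is obtained from the other by a cyclic
rotation followed by a relabeling (a bijection of `{1, …, n}` applied to all entries). -/
def SameDiagram (n : ℕ) (N M : List ℕ) : Prop :=
  ∃ (k : ℕ) (σ : Equiv.Perm ℕ),
    (∀ x, 1 ≤ x → x ≤ n → 1 ≤ σ x ∧ σ x ≤ n) ∧ M = (N.rotate k).map σ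

/-- A chord word `W` on `m` strands is a braiding of the `n`-diagram named by `N` if the
standard name read from `W` is a name of that diagram. -/
def IsBraiding (n m : ℕ) (W : List (ℕ × ℕ)) (N : List ℕ) : Prop :=
  IsChordWord m W ∧ SameDiagram n (standardName m W) N

/-- The braid index of the diagram named by `N`: the least number `m ≥ 1` of strands of
any braiding of the diagram. -/
noncomputable def braidIndex (n : ℕ) (N : List ℕ) : ℕ :=
  sInf {m | 1 ≤ m ∧ ∃ W, IsBraiding n m W N}

/-- The increasing list of the (0-based) positions at which `x` occurs in `N`. -/
def positionsOf (N : List ℕ) (x : ℕ) : List ℕ :=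
  (List.range N.length).filter fun p => decide (N.getD p 0 = x)

/-- The canonical braiding of a name `N` of an `n`-diagram: the chord word
`A(i_1,j_1) ⋯ A(i_n,j_n)` on `2n` strands, where `i_r < j_r` are the two (1-based)
positions at which the label `r` occurs in `N`. -/
def canonicalBraiding (n : ℕ) (N : List ℕ) : List (ℕ × ℕ) :=
  (List.range n).map fun r =>
    ((positionsOf N (r + 1)).getD 0 0 + 1, (positionsOf N (r + 1)).getD 1 0 + 1)

/-- Commutation move: interchange two adjacent generators with disjoint endpoint sets. -/
def CommMove (V W : List (ℕ × ℕ)) : Prop :=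
  ∃ (U V' : List (ℕ × ℕ)) (i j k l : ℕ),
    i ≠ k ∧ i ≠ l ∧ j ≠ k ∧ j ≠ l ∧
    V = U ++ (i, j) :: (k, l) :: V' ∧ W = U ++ (k, l) :: (i, j) :: V'

/-- Cyclic permutation move on `m` strands: replace `W'·A(i,j)` by `A(i+1,j+1)·W'` when
`j < m`, and `W'·A(i,m)` by `A(1,i+1)·W'`. -/
def CycMove (m : ℕ) (V W : List (ℕ × ℕ)) : Prop :=
  (∃ (U : List (ℕ × ℕ)) (i j : ℕ), j < m ∧ V = U ++ [(i, j)] ∧ W = (i + 1, j + 1) :: U) ∨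
  (∃ (U : List (ℕ × ℕ)) (i : ℕ), V = U ++ [(i, m)] ∧ W = (1, i + 1) :: U)

/-- Stabilization move: replace the word `U·A(i,m)` on `m` strands by `U·A(i,m+1)` on
`m+1` strands. Words are recorded together with their number of strands. -/
def StabMove (p q : ℕ × List (ℕ × ℕ)) : Prop :=
  ∃ (U : List (ℕ × ℕ)) (i m : ℕ),
    p = (m, U ++ [(i, m)]) ∧ q = (m + 1, U ++ [(i, m + 1)])

/-- A single move on chord-words-with-strand-count: a commutation move, a cyclic
permutation move (in either direction), or a stabilization move (in either direction). -/
def Move (p q : ℕ × List (ℕ × ℕ)) : Prop :=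
  (p.1 = q.1 ∧ (CommMove p.2 q.2 ∨ CycMove p.1 p.2 q.2 ∨ CycMove p.1 q.2 p.2)) ∨
    StabMove p q ∨ StabMove q p

/-- Two chord-words-with-strand-count are related by a finite sequence of commutation,
cyclic permutation and stabilization moves. -/
def MoveEquiv (p q : ℕ × List (ℕ × ℕ)) : Prop :=
  Relation.ReflTransGen Move p q

/-- A commutation or cyclic permutation move (in either direction) on `m` strands. -/
def CCMove (m : ℕ) (V W : List (ℕ × ℕ)) : Prop :=
  CommMove V W ∨ CycMove m V W ∨ CycMove m W V

/-- Related by a finite sequence of commutation and cyclic permutation moves. -/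
def CCEquiv (m : ℕ) : List (ℕ × ℕ) → List (ℕ × ℕ) → Prop :=
  Relation.ReflTransGen (CCMove m)

/-- Cyclic equivalence on `m` strands: related by a finite sequence of cyclic
permutation moves. -/
def CycEquiv (m : ℕ) : List (ℕ × ℕ) → List (ℕ × ℕ) → Prop :=
  Relation.ReflTransGen fun V W => CycMove m V W ∨ CycMove m W V

/-- Decrease by one every strand index greater than `j`. -/
def shiftGt (j : ℕ) (W : List (ℕ × ℕ)) : List (ℕ × ℕ) :=
  W.map fun p => ((if j < p.1 then p.1 - 1 else p.1), (if j < p.2 then p.2 - 1 else p.2))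

/-- Decrease by one every strand index greater than or equal to `j`. -/
def shiftGe (j : ℕ) (W : List (ℕ × ℕ)) : List (ℕ × ℕ) :=
  W.map fun p => ((if j ≤ p.1 then p.1 - 1 else p.1), (if j ≤ p.2 then p.2 - 1 else p.2))

/-- Decreasing stabilization: replace `U·A(i,j)·V` on `m` strands (where `i < j - 1`,
the strand index `j` does not occur in `U`, and `j - 1` does not occur in `V`) by
`U'·A(i,j-1)·V'` on `m - 1` strands, where `U'` is `U` with every index `> j` decreased
by one and `V'` is `V` with every index `≥ j` decreased by one. -/
def DecStab (p q : ℕ × List (ℕ × ℕ)) : Prop :=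
  ∃ (U V : List (ℕ × ℕ)) (i j : ℕ),
    i + 1 < j ∧
    (∀ x ∈ U, x.1 ≠ j ∧ x.2 ≠ j) ∧
    (∀ x ∈ V, x.1 ≠ j - 1 ∧ x.2 ≠ j - 1) ∧
    p.2 = U ++ (i, j) :: V ∧
    q = (p.1 - 1, shiftGt j U ++ (i, j - 1) :: shiftGe j V)

/-- The blow-up of a name `N` with weights `w`: both occurrences of each label `r` are
replaced by the same ordered block of `w r` distinct fresh labels. -/
def blowUp (w : ℕ → ℕ) (N : List ℕ) : List ℕ :=
  N.flatMap fun r => (List.range (w r)).map fun t => (∑ s ∈ Finset.Ico 1 r, w s) + t + 1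

/-- The chord word obtained from `Wa` by repeating its `r`-th generator `w r` times
consecutively, in place. -/
def powerWord (w : ℕ → ℕ) (Wa : List (ℕ × ℕ)) : List (ℕ × ℕ) :=
  (List.range Wa.length).flatMap fun r => List.replicate (w (r + 1)) (Wa.getD r (0, 0))

/-- The diagram named by `N` is amalgamated: no name of the diagram is (cyclically) of
the form `x y U x y V` with `x ≠ y`. -/
def Amalgamated (n : ℕ) (N : List ℕ) : Prop :=
  ¬∃ (x y : ℕ) (U V : List ℕ), x ≠ y ∧ SameDiagram n N (x :: y :: (U ++ x :: y :: V))

/-- The chords labeled `r` and `s` cross in the name `N`: their occurrences interleave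
cyclically. -/
def Crosses (N : List ℕ) (r s : ℕ) : Prop :=
  ∃ k, [r, s, r, s].Sublist (N.rotate k)

namespace BraidAux

/-- Does generator `g` touch strand `s`? -/
def tch (g : ℕ × ℕ) (s : ℕ) : Prop := g.1 = s ∨ g.2 = s

instance (g : ℕ × ℕ) (s : ℕ) : Decidable (tch g s) := by unfold tch; infer_instance

/-- Contents of strand `s` of a labelled block word. -/
def strand (L : List ((ℕ × ℕ) × List ℕ)) (s : ℕ) : List ℕ :=
  L.flatMap fun p => if tch p.1 s then p.2 else []

/-- The name read from a labelled block word. -/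
def rd (m : ℕ) (L : List ((ℕ × ℕ) × List ℕ)) : List ℕ :=
  (List.range m).flatMap fun s => strand L (s + 1)

/-- The underlying chord word. -/
def flat (L : List ((ℕ × ℕ) × List ℕ)) : List (ℕ × ℕ) :=
  L.flatMap fun p => List.replicate p.2.length p.1

/-- All the labels. -/
def labs (L : List ((ℕ × ℕ) × List ℕ)) : List ℕ := L.flatMap fun p => p.2

/-- The weights. -/
def wts (L : List ((ℕ × ℕ) × List ℕ)) (r : ℕ) : ℕ := (L.getD (r - 1) ((0, 0), [])).2.length

/-- The cyclic shift of a generator. -/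
def shift (m : ℕ) (g : ℕ × ℕ) : ℕ × ℕ := if g.2 < m then (g.1 + 1, g.2 + 1) else (1, g.1 + 1)

def ChordW (m : ℕ) (L : List ((ℕ × ℕ) × List ℕ)) : Prop :=
  ∀ p ∈ L, 1 ≤ p.1.1 ∧ p.1.1 < p.1.2 ∧ p.1.2 ≤ m

structure Inv (n m : ℕ) (W : List (ℕ × ℕ)) (D : List ℕ) (L : List ((ℕ × ℕ) × List ℕ)) :
    Prop where
  chord : ChordW m L
  ne : ∀ p ∈ L, 1 ≤ p.2.length
  cc : CCEquiv m W (flat L)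
  perm : (labs L).Perm (List.range' 1 n)
  rot : (rd m L).IsRotated D

theorem strand_append (L M : List ((ℕ × ℕ) × List ℕ)) (s : ℕ) :
    strand (L ++ M) s = strand L s ++ strand M s := by simp [strand]

theorem strand_cons (p : (ℕ × ℕ) × List ℕ) (M : List ((ℕ × ℕ) × List ℕ)) (s : ℕ) :
    strand (p :: M) s = (if tch p.1 s then p.2 else []) ++ strand M s := by simp [strand]

/-! ### Commutation -/

theorem cc_comm_one (m : ℕ) (p q : ℕ × ℕ) (h : p.1 ≠ q.1 ∧ p.1 ≠ q.2 ∧ p.2 ≠ q.1 ∧ p.2 ≠ q.2)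
    (U V : List (ℕ × ℕ)) (b : ℕ) :
    CCEquiv m (U ++ p :: (List.replicate b q ++ V)) (U ++ (List.replicate b q ++ p :: V)) := by
  induction b generalizing U with
  | zero => exact Relation.ReflTransGen.refl
  | succ b ih =>
    refine Relation.ReflTransGen.head (b := U ++ q :: p :: (List.replicate b q ++ V)) ?_ ?_
    · left
      exact ⟨U, List.replicate b q ++ V, p.1, p.2, q.1, q.2, h.1, h.2.1, h.2.2.1, h.2.2.2,
        by simp [List.replicate_succ], rfl⟩
    · have := ih (U ++ [q])
      simpa [CCEquiv, List.replicate_succ] using this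

theorem cc_comm (m : ℕ) (p q : ℕ × ℕ) (h : p.1 ≠ q.1 ∧ p.1 ≠ q.2 ∧ p.2 ≠ q.1 ∧ p.2 ≠ q.2)
    (U V : List (ℕ × ℕ)) (a b : ℕ) :
    CCEquiv m (U ++ (List.replicate a p ++ (List.replicate b q ++ V)))
      (U ++ (List.replicate b q ++ (List.replicate a p ++ V))) := by
  induction a generalizing U with
  | zero => exact Relation.ReflTransGen.refl
  | succ a ih =>
    have h1 := ih (U ++ [p])
    have h2 := cc_comm_one m p q h U (List.replicate a p ++ V) b
    refine Relation.ReflTransGen.trans (b := U ++ p :: (List.replicate b q ++ (List.replicate a p ++ V))) ?_ ?_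
    · simpa [CCEquiv, List.replicate_succ] using h1
    · simpa [CCEquiv, List.replicate_succ] using h2

theorem Inv.comm {n m : ℕ} {W : List (ℕ × ℕ)} {D : List ℕ} {U V : List ((ℕ × ℕ) × List ℕ)}
    {p q : (ℕ × ℕ) × List ℕ} (h : Inv n m W D (U ++ p :: q :: V))
    (hd : ∀ s, tch p.1 s → ¬ tch q.1 s) : Inv n m W D (U ++ q :: p :: V) := by
  have hP : (U ++ q :: p :: V).Perm (U ++ p :: q :: V) :=
    List.Perm.append_left U (List.Perm.swap _ _ _)
  refine ⟨fun x hx => h.chord x (hP.subset hx), fun x hx => h.ne x (hP.subset hx), ?_, ?_, ?_⟩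
  · refine h.cc.trans ?_
    have := cc_comm m p.1 q.1 ?_ (flat U) (flat V) p.2.length q.2.length
    · simpa [CCEquiv, flat] using this
    · have h1 := hd p.1.1 (Or.inl rfl)
      have h2 := hd p.1.2 (Or.inr rfl)
      unfold tch at h1 h2
      push Not at h1 h2
      exact ⟨fun e => h1.1 e.symm, fun e => h1.2 e.symm, fun e => h2.1 e.symm, fun e => h2.2 e.symm⟩
  · exact (List.Perm.flatMap_right _ hP).trans h.perm
  · have : rd m (U ++ q :: p :: V) = rd m (U ++ p :: q :: V) := by
      unfold rd
      congr 1
      funext s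
      simp only [strand_append, strand_cons]
      by_cases h1 : tch p.1 (s + 1)
      · simp [hd _ h1]
      · simp [h1]
    rw [this]; exact h.rot

/-- Move a block to the right past a list of disjoint blocks. -/
theorem Inv.comm_right {n m : ℕ} {W : List (ℕ × ℕ)} {D : List ℕ}
    {p : (ℕ × ℕ) × List ℕ} (M : List ((ℕ × ℕ) × List ℕ)) :
    ∀ {U V : List ((ℕ × ℕ) × List ℕ)}, Inv n m W D (U ++ p :: (M ++ V)) →
    (∀ q ∈ M, ∀ s, tch p.1 s → ¬ tch q.1 s) → Inv n m W D (U ++ M ++ p :: V) := by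
  induction M with
  | nil => intro U V h _; simpa using h
  | cons q M ih =>
    intro U V h hd
    have h1 : Inv n m W D (U ++ q :: p :: (M ++ V)) :=
      Inv.comm (by simpa using h) (hd q (by simp))
    have h2 := ih (U := U ++ [q]) (V := V) (by simpa using h1)
      (fun q' hq' => hd q' (by simp [hq']))
    simpa using h2

/-- Merge two adjacent blocks. -/
theorem Inv.merge {n m : ℕ} {W : List (ℕ × ℕ)} {D : List ℕ} {U V : List ((ℕ × ℕ) × List ℕ)}
    {g : ℕ × ℕ} {l1 l2 : List ℕ} (h : Inv n m W D (U ++ (g, l1) :: (g, l2) :: V)) :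
    Inv n m W D (U ++ (g, l1 ++ l2) :: V) := by
  refine ⟨?_, ?_, ?_, ?_, ?_⟩
  · intro p hp
    have := h.chord
    simp only [List.mem_append, List.mem_cons] at hp
    rcases hp with hp | hp | hp
    · exact this p (by simp [hp])
    · have := this (g, l1) (by simp)
      rw [hp]; exact this
    · exact this p (by simp [hp])
  · intro p hp
    have := h.ne
    simp only [List.mem_append, List.mem_cons] at hp
    rcases hp with hp | hp | hp
    · exact this p (by simp [hp])
    · have := this (g, l1) (by simp)
      rw [hp]; simp only [List.length_append] at *; omega
    · exact this p (by simp [hp])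
  · have e : flat (U ++ (g, l1 ++ l2) :: V) = flat (U ++ (g, l1) :: (g, l2) :: V) := by
      simp [flat, ← List.append_assoc]
    rw [e]; exact h.cc
  · have e : labs (U ++ (g, l1 ++ l2) :: V) = labs (U ++ (g, l1) :: (g, l2) :: V) := by
      simp [labs]
    rw [e]; exact h.perm
  · have e : rd m (U ++ (g, l1 ++ l2) :: V) = rd m (U ++ (g, l1) :: (g, l2) :: V) := by
      unfold rd
      congr 1
      funext s
      simp only [strand_append, strand_cons]
      by_cases h1 : tch g (s + 1) <;> simp [h1]
    rw [e]; exact h.rot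

/-! ### Cyclic moves -/

theorem cc_cyc_one (m : ℕ) (g : ℕ × ℕ) (hg : g.2 ≤ m) (X : List (ℕ × ℕ)) :
    CCMove m (X ++ [g]) (shift m g :: X) := by
  right; left
  unfold shift
  by_cases h : g.2 < m
  · left; exact ⟨X, g.1, g.2, h, rfl, by simp [h]⟩
  · right
    have : g.2 = m := by omega
    refine ⟨X, g.1, ?_, by simp [h]⟩
    rw [← this]

theorem cc_cyc (m : ℕ) (g : ℕ × ℕ) (hg : g.2 ≤ m) (k : ℕ) (X : List (ℕ × ℕ)) :
    CCEquiv m (X ++ List.replicate k g) (List.replicate k (shift m g) ++ X) := by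
  induction k generalizing X with
  | zero => simp only [List.replicate_zero, List.append_nil, List.nil_append]; exact Relation.ReflTransGen.refl
  | succ k ih =>
    refine Relation.ReflTransGen.head (b := shift m g :: (X ++ List.replicate k g)) ?_ ?_
    · have := cc_cyc_one m g hg (X ++ List.replicate k g)
      simpa [List.replicate_succ'] using this
    · have := ih (shift m g :: X)
      simpa [CCEquiv, List.replicate_succ'] using this

theorem rot_aux (S e : ℕ → List ℕ) (k : ℕ) :
    (List.range (k + 1)).flatMap (fun s => S s ++ e s) =
      (S 0 ++ (List.range k).flatMap fun s => e s ++ S (s + 1)) ++ e k := by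
  induction k with
  | zero => simp
  | succ k ih =>
    rw [List.range_succ, List.flatMap_append, ih, List.range_succ (n := k), List.flatMap_append]
    simp

theorem rot_aux2 (S e : ℕ → List ℕ) (k : ℕ) :
    (List.range (k + 1)).flatMap (fun s => e s ++ S s) =
      e 0 ++ (S 0 ++ (List.range k).flatMap fun s => e (s + 1) ++ S (s + 1)) := by
  rw [List.range_succ_eq_map]
  simp [List.flatMap_map]

theorem tch_shift {m : ℕ} {g : ℕ × ℕ} (hg : 1 ≤ g.1 ∧ g.1 < g.2 ∧ g.2 ≤ m) {a : ℕ}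
    (ha : a < m) (ha1 : 1 ≤ a) : tch (shift m g) (a + 1) ↔ tch g a := by
  unfold tch shift
  split_ifs <;> simp <;> omega

theorem tch_shift_top {m : ℕ} {g : ℕ × ℕ} (hg : 1 ≤ g.1 ∧ g.1 < g.2 ∧ g.2 ≤ m) :
    tch (shift m g) 1 ↔ tch g m := by
  unfold tch shift
  split_ifs <;> simp <;> omega

theorem Inv.cyc {n m : ℕ} {W : List (ℕ × ℕ)} {D : List ℕ} {U : List ((ℕ × ℕ) × List ℕ)}
    {p : (ℕ × ℕ) × List ℕ} (h : Inv n m W D (U ++ [p])) :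
    Inv n m W D ((shift m p.1, p.2) :: U) := by
  have hp := h.chord p (by simp)
  refine ⟨?_, ?_, ?_, ?_, ?_⟩
  · intro q hq
    rw [List.mem_cons] at hq
    rcases hq with rfl | hq
    · unfold shift; dsimp only; split_ifs <;> dsimp only <;> omega
    · exact h.chord q (by simp [hq])
  · intro q hq
    rw [List.mem_cons] at hq
    rcases hq with rfl | hq
    · exact h.ne p (by simp)
    · exact h.ne q (by simp [hq])
  · refine h.cc.trans ?_
    have := cc_cyc m p.1 hp.2.2 p.2.length (flat U)
    simpa [CCEquiv, flat] using this
  · refine List.Perm.trans ?_ h.perm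
    simp only [labs, List.flatMap_cons, List.flatMap_append, List.flatMap_nil, List.append_nil]
    exact List.perm_append_comm
  · refine List.IsRotated.trans ?_ h.rot
    obtain ⟨k, rfl⟩ : ∃ k, m = k + 1 := ⟨m - 1, by omega⟩
    have e1 : rd (k + 1) (U ++ [p]) = _ :=
      (by
        unfold rd
        simp only [strand_append, strand_cons]
        simp [strand] : _ = (List.range (k + 1)).flatMap (fun s => strand U (s + 1) ++ (if tch p.1 (s + 1) then p.2 else []))).trans
      (rot_aux (fun s => strand U (s + 1)) (fun s => if tch p.1 (s + 1) then p.2 else []) k)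
    have e2 : rd (k + 1) ((shift (k + 1) p.1, p.2) :: U) = _ :=
      (by
        unfold rd
        simp only [strand_cons] : _ = (List.range (k + 1)).flatMap (fun s => (if tch (shift (k + 1) p.1) (s + 1) then p.2 else []) ++ strand U (s + 1))).trans
      (rot_aux2 (fun s => strand U (s + 1)) (fun s => if tch (shift (k + 1) p.1) (s + 1) then p.2 else []) k)
    rw [e1, e2]
    have e3 : (List.range k).flatMap (fun s => (if tch (shift (k + 1) p.1) (s + 1 + 1) then p.2 else []) ++ strand U (s + 1 + 1))
        = (List.range k).flatMap (fun s => (if tch p.1 (s + 1) then p.2 else []) ++ strand U (s + 1 + 1)) := by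
      apply List.flatMap_congr
      intro s hs
      rw [List.mem_range] at hs
      simp only [tch_shift hp (a := s + 1) (by omega) (by omega)]
    rw [e3]
    simp only [zero_add, tch_shift_top hp]
    exact List.isRotated_append

/-- Rotate a whole suffix. -/
theorem Inv.cyc_suffix {n m : ℕ} {W : List (ℕ × ℕ)} {D : List ℕ} (V : List ((ℕ × ℕ) × List ℕ)) :
    ∀ {U : List ((ℕ × ℕ) × List ℕ)}, Inv n m W D (U ++ V) →
    Inv n m W D (V.map (fun p => (shift m p.1, p.2)) ++ U) := by
  induction V using List.reverseRecOn with
  | nil => intro U h; simpa using h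
  | append_singleton V p ih =>
    intro U h
    have h1 : Inv n m W D ((shift m p.1, p.2) :: (U ++ V)) := Inv.cyc (by simpa using h)
    have h2 := ih (U := (shift m p.1, p.2) :: U) (by simpa using h1)
    simpa using h2

/-! ### Relabelling -/

theorem exists_sigma {n : ℕ} {l : List ℕ} (h : l.Perm (List.range' 1 n)) :
    ∃ σ : Equiv.Perm ℕ, (∀ x, 1 ≤ x → x ≤ n → 1 ≤ σ x ∧ σ x ≤ n) ∧
      ∀ i, i < n → σ (i + 1) = l.getD i 0 := by
  have hlen : l.length = n := by simpa using h.length_eq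
  have hnd : l.Nodup := h.nodup_iff.2 List.nodup_range'
  have hmem : ∀ x, x ∈ l ↔ 1 ≤ x ∧ x ≤ n := by
    intro x; rw [h.mem_iff, List.mem_range'_1]; omega
  let f : ℕ → ℕ := fun x => if 1 ≤ x ∧ x ≤ n then l.getD (x - 1) 0 else x
  have hf : ∀ x, 1 ≤ x → x ≤ n → f x ∈ l := by
    intro x h1 h2
    have : x - 1 < l.length := by omega
    simp only [f, h1, h2, and_self, if_true, List.getD_eq_getElem _ _ this]
    exact List.getElem_mem _
  have hinj : Function.Injective f := by
    intro x y hxy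
    by_cases hx : 1 ≤ x ∧ x ≤ n <;> by_cases hy : 1 ≤ y ∧ y ≤ n
    · have h1 : x - 1 < l.length := by omega
      have h2 : y - 1 < l.length := by omega
      simp only [f, hx, hy, and_self, if_true, List.getD_eq_getElem _ _ h1,
        List.getD_eq_getElem _ _ h2] at hxy
      have := (hnd.getElem_inj_iff).1 hxy
      omega
    · have h1 := (hmem _).1 (hf x hx.1 hx.2)
      have h2 : f y = y := by simp only [f, hy, if_false]
      rw [hxy, h2] at h1; exact absurd h1 hy
    · have h1 := (hmem _).1 (hf y hy.1 hy.2)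
      have h2 : f x = x := by simp only [f, hx, if_false]
      rw [← hxy, h2] at h1; exact absurd h1 hx
    · simpa only [f, hx, hy, if_false] using hxy
  have hsurj : Function.Surjective f := by
    intro y
    by_cases hy : 1 ≤ y ∧ y ≤ n
    · obtain ⟨i, hi, rfl⟩ := List.mem_iff_getElem.1 ((hmem y).2 hy)
      refine ⟨i + 1, ?_⟩
      have : 1 ≤ i + 1 ∧ i + 1 ≤ n := by omega
      simp only [f, this, and_self, if_true, Nat.add_sub_cancel, List.getD_eq_getElem _ _ hi]
    · exact ⟨y, by simp only [f, hy, if_false]⟩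
  refine ⟨Equiv.ofBijective f ⟨hinj, hsurj⟩, ?_, ?_⟩
  · intro x h1 h2
    exact (hmem _).1 (hf x h1 h2)
  · intro i hi
    have : 1 ≤ i + 1 ∧ i + 1 ≤ n := by omega
    have e : Equiv.ofBijective f ⟨hinj, hsurj⟩ (i + 1) = f (i + 1) := rfl
    rw [e]
    simp only [f, this, and_self, if_true, Nat.add_sub_cancel]

theorem strand_eq (L : List ((ℕ × ℕ) × List ℕ)) (s : ℕ) :
    strand L s = ((List.range L.length).filter
      (fun r => decide (((L.map (·.1)).getD r (0, 0)).1 = s ∨ ((L.map (·.1)).getD r (0, 0)).2 = s))).flatMap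
      (fun r => (L.getD r ((0, 0), [])).2) := by
  induction L using List.reverseRecOn with
  | nil => simp [strand]
  | append_singleton L p ih =>
    rw [strand_append, ih, List.length_append, List.length_singleton, List.range_succ,
      List.filter_append, List.flatMap_append]
    congr 1
    · rw [List.filter_congr (l := List.range L.length) (p := fun r => decide ((((L ++ [p]).map (·.1)).getD r (0, 0)).1 = s ∨
        (((L ++ [p]).map (·.1)).getD r (0, 0)).2 = s)) (q := fun r => decide (((L.map (·.1)).getD r (0, 0)).1 = s ∨
        ((L.map (·.1)).getD r (0, 0)).2 = s))]
      · apply List.flatMap_congr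
        intro r hr
        have := (List.mem_filter.1 hr).1
        rw [List.mem_range] at this
        rw [List.getD_append _ _ _ _ this]
      · intro r hr
        rw [List.mem_range] at hr
        rw [List.map_append, List.getD_append _ _ _ _ (by simpa using hr)]
    · by_cases h : p.1.1 = s ∨ p.1.2 = s <;> simp [strand, tch, h]

theorem labs_block (L : List ((ℕ × ℕ) × List ℕ)) (r : ℕ) (hr : r < L.length) :
    (List.range (wts L (r + 1))).map
      (fun t => (labs L).getD ((∑ s ∈ Finset.Ico 1 (r + 1), wts L s) + t) 0) =
      (L.getD r ((0, 0), [])).2 ∧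
    (∑ s ∈ Finset.Ico 1 (r + 1), wts L s) + wts L (r + 1) ≤ (labs L).length := by
  have hsum : ∀ r, r < L.length → (∑ s ∈ Finset.Ico 1 (r + 1), wts L s) = (labs (L.take r)).length := by
    intro r
    induction r with
    | zero => simp [labs]
    | succ r ih =>
      intro hr
      rw [Finset.sum_Ico_succ_top (by omega), ih (by omega), List.take_add_one]
      have : r < L.length := by omega
      simp [wts, labs, this]
  rw [hsum r hr]
  have hsplit : labs L = labs (L.take r) ++ ((L.getD r ((0, 0), [])).2 ++ labs (L.drop (r + 1))) := by
    conv_lhs => rw [← List.take_append_drop r L, List.drop_eq_getElem_cons hr]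
    rw [List.getD_eq_getElem _ _ hr]
    simp only [labs, List.flatMap_append, List.flatMap_cons]
  have hw : wts L (r + 1) = (L.getD r ((0, 0), [])).2.length := by simp [wts]
  rw [hw, hsplit]
  constructor
  · apply List.ext_getElem
    · simp
    · intro i h1 h2
      simp only [List.getElem_map, List.getElem_range]
      rw [List.getD_append_right _ _ _ _ (by omega), Nat.add_sub_cancel_left,
        List.getD_append _ _ _ _ h2, List.getD_eq_getElem _ _ h2]
  · simp only [List.length_append]; omega

theorem relabel {n : ℕ} (m : ℕ) {L : List ((ℕ × ℕ) × List ℕ)} {σ : ℕ → ℕ}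
    (hl : (labs L).length = n) (hσ : ∀ i, i < n → σ (i + 1) = (labs L).getD i 0) :
    (blowUp (wts L) (standardName m (L.map (·.1)))).map σ = rd m L := by
  unfold blowUp standardName rd
  rw [List.flatMap_assoc, List.map_flatMap]
  congr 1
  funext s
  rw [strand_eq, List.length_map, List.flatMap_map, List.map_flatMap]
  apply List.flatMap_congr
  intro r hr
  have hr := (List.mem_filter.1 hr).1
  rw [List.mem_range] at hr
  obtain ⟨h1, h2⟩ := labs_block L r hr
  rw [← h1, List.map_map]
  apply List.map_congr_left
  intro t ht
  rw [List.mem_range] at ht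
  exact hσ _ (by omega)

theorem blow_same {n m : ℕ} {D : List ℕ} {L : List ((ℕ × ℕ) × List ℕ)}
    (hp : (labs L).Perm (List.range' 1 n)) (hr : (rd m L).IsRotated D) :
    SameDiagram n (blowUp (wts L) (standardName m (L.map (·.1)))) D := by
  obtain ⟨σ, h1, h2⟩ := exists_sigma hp
  have := relabel m (by simpa using hp.length_eq) h2
  obtain ⟨k, hk⟩ := hr
  refine ⟨k, σ, h1, ?_⟩
  rw [← hk, ← this, List.map_rotate]

theorem SameDiagram.isName {n : ℕ} {N M : List ℕ} (h : SameDiagram n N M) (hM : IsName n M) :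
    IsName n N := by
  obtain ⟨k, σ, h1, rfl⟩ := h
  refine ⟨by simpa using hM.1, fun r hr1 hr2 => ?_⟩
  have := hM.2 (σ r) (h1 r hr1 hr2).1 (h1 r hr1 hr2).2
  rw [List.count_map_of_injective _ _ σ.injective] at this
  rwa [(List.rotate_perm N k).count_eq] at this

/-- Singleton labelled word. -/
def sing (W : List (ℕ × ℕ)) (f : ℕ → ℕ) : List ((ℕ × ℕ) × List ℕ) :=
  (List.range W.length).map fun i => (W.getD i (0, 0), [f (i + 1)])

theorem rd_sing (m : ℕ) (W : List (ℕ × ℕ)) (f : ℕ → ℕ) :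
    rd m (sing W f) = (standardName m W).map f := by
  unfold rd standardName
  rw [List.map_flatMap]
  congr 1
  funext s
  unfold strand sing
  rw [List.flatMap_map, List.map_map]
  generalize List.range W.length = l
  induction l with
  | nil => rfl
  | cons a l ih =>
    rw [List.flatMap_cons, ih, List.filter_cons]
    by_cases h : (W.getD a (0, 0)).1 = s + 1 ∨ (W.getD a (0, 0)).2 = s + 1
    · simp only [tch, h, if_true, decide_true]; simp
    · simp only [tch, h, if_false, decide_false]; simp

theorem map_range_getD {α : Type*} (W : List α) (d : α) :
    (List.range W.length).map (fun i => W.getD i d) = W := by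
  apply List.ext_getElem
  · simp
  · intro i h1 h2
    simp [h2]

theorem sing_fst (W : List (ℕ × ℕ)) (f : ℕ → ℕ) : (sing W f).map (·.1) = W := by
  unfold sing
  rw [List.map_map]
  exact map_range_getD W (0, 0)

theorem flat_sing (W : List (ℕ × ℕ)) (f : ℕ → ℕ) : flat (sing W f) = W := by
  conv_rhs => rw [← map_range_getD W (0, 0)]
  unfold flat sing
  rw [List.flatMap_map]
  simp [List.map_eq_flatMap]

theorem labs_sing (W : List (ℕ × ℕ)) (f : ℕ → ℕ) :
    labs (sing W f) = (List.range' 1 W.length).map f := by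
  unfold labs sing
  rw [List.flatMap_map, List.range'_eq_map_range, List.map_map, List.map_eq_flatMap]
  congr 1
  funext a
  simp [Nat.add_comm]

theorem chord_sing {m : ℕ} {W : List (ℕ × ℕ)} (h : IsChordWord m W) (f : ℕ → ℕ) :
    ChordW m (sing W f) := by
  intro p hp
  apply h
  rw [← sing_fst W f]
  exact List.mem_map_of_mem hp

theorem rd_single {m : ℕ} {p : (ℕ × ℕ) × List ℕ} (h : 1 ≤ p.1.1 ∧ p.1.1 < p.1.2 ∧ p.1.2 ≤ m) :
    rd m [p] = p.2 ++ p.2 := by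
  obtain ⟨a, ha⟩ : ∃ a, p.1.1 = a + 1 := ⟨p.1.1 - 1, by omega⟩
  obtain ⟨b, hb⟩ : ∃ b, p.1.2 = a + 1 + b + 1 := ⟨p.1.2 - p.1.1 - 1, by omega⟩
  obtain ⟨c, rfl⟩ : ∃ c, m = a + (1 + (b + (1 + c))) := ⟨m - p.1.2, by omega⟩
  have hz : ∀ (k : ℕ) (g : ℕ → ℕ), (∀ s, s < k → ¬ tch p.1 (g s + 1)) →
      (List.range k).flatMap (fun s => strand [p] (g s + 1)) = [] := by
    intro k g hk
    rw [List.flatMap_eq_nil_iff]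
    intro s hs
    rw [List.mem_range] at hs
    simp [strand, hk s hs]
  unfold rd
  simp only [List.range_add, List.flatMap_append, List.flatMap_map, List.range_one, List.map_append, List.map_map]
  rw [hz a (fun s => s) (by intro s hs; unfold tch; omega)]
  have h1 := hz b (fun s => a + (1 + s)) (by intro s hs; unfold tch; omega)
  have h2 := hz c (fun s => a + (1 + (b + (1 + s)))) (by intro s hs; unfold tch; omega)
  simp only [Function.comp_def]
  rw [h1, h2]
  have h3 : tch p.1 (a + 1) := Or.inl ha
  have h4 : tch p.1 (a + (1 + b) + 1) := Or.inr (by omega)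
  simp [strand, h3, h4]

theorem flatMap_append_perm (l : List ℕ) (f g : ℕ → List ℕ) :
    (l.flatMap fun s => f s ++ g s).Perm (l.flatMap f ++ l.flatMap g) :=
  (List.flatMap_append_perm l f g).symm

theorem rd_perm {m : ℕ} {L : List ((ℕ × ℕ) × List ℕ)} (h : ChordW m L) :
    (rd m L).Perm (labs L ++ labs L) := by
  induction L with
  | nil => simp [rd, strand, labs]
  | cons p L ih =>
    have h1 := ih (fun q hq => h q (by simp [hq]))
    have h2 := rd_single (h p (by simp))
    have h3 : (rd m (p :: L)).Perm (rd m [p] ++ rd m L) := by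
      have : rd m (p :: L) = (List.range m).flatMap fun s => strand [p] (s + 1) ++ strand L (s + 1) := by
        unfold rd; congr 1; funext s; rw [← strand_append]; rfl
      rw [this]
      exact flatMap_append_perm _ _ _
    refine h3.trans ?_
    rw [h2]
    have : labs (p :: L) = p.2 ++ labs L := by simp [labs]
    rw [this]
    refine (List.Perm.append_left _ h1).trans ?_
    simp only [List.append_assoc]
    refine List.Perm.append_left _ ?_
    simp only [← List.append_assoc]
    exact List.Perm.append_right _ List.perm_append_comm

theorem sn_perm {m : ℕ} {W : List (ℕ × ℕ)} (h : IsChordWord m W) :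
    (standardName m W).Perm (List.range' 1 W.length ++ List.range' 1 W.length) := by
  have h1 := rd_perm (chord_sing h (fun x => x))
  rw [rd_sing, labs_sing] at h1
  simpa using h1

theorem sn_isName {m : ℕ} {W : List (ℕ × ℕ)} (h : IsChordWord m W) :
    IsName W.length (standardName m W) := by
  have h1 := sn_perm h
  refine ⟨by rw [h1.length_eq]; simp; omega, fun r hr1 hr2 => ?_⟩
  rw [h1.count_eq, List.count_append, List.count_eq_one_of_mem List.nodup_range'
    (List.mem_range'_1.2 (by omega))]

theorem blowUp_one (m : ℕ) {W : List (ℕ × ℕ)} (h : IsChordWord m W) (w : ℕ → ℕ)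
    (hw : ∀ r, 1 ≤ r → r ≤ W.length → w r = 1) :
    blowUp w (standardName m W) = standardName m W := by
  have hm : ∀ r ∈ standardName m W, 1 ≤ r ∧ r ≤ W.length := by
    intro r hr
    have := (sn_perm h).subset hr
    simp only [List.mem_append, or_self, List.mem_range'_1] at this
    omega
  unfold blowUp
  rw [List.flatMap_congr (g := fun r => [r])]
  · simp
  · intro r hr
    obtain ⟨h1, h2⟩ := hm r hr
    rw [hw r h1 h2, Finset.sum_congr rfl (g := fun _ => 1)]
    · simp; omega
    · intro x hx
      rw [Finset.mem_Ico] at hx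
      exact hw x (by omega) (by omega)

end BraidAux
namespace BraidAux

/-! ### Removing an empty strand -/

/-- Contract strand `c`. -/
def con (c : ℕ) (g : ℕ × ℕ) : ℕ × ℕ :=
  (if g.1 < c then g.1 else g.1 - 1, if g.2 < c then g.2 else g.2 - 1)

theorem tch_con {c : ℕ} {g : ℕ × ℕ} (hg : ¬ tch g c) (h1 : 1 ≤ g.1) (h2 : 1 ≤ g.2) (s : ℕ) :
    tch (con c g) s ↔ tch g (if s < c then s else s + 1) := by
  unfold tch con at *
  dsimp only
  split_ifs <;> omega

/-- Contract and split into singletons. -/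
def conL (c : ℕ) (L : List ((ℕ × ℕ) × List ℕ)) : List ((ℕ × ℕ) × List ℕ) :=
  L.flatMap fun p => p.2.map fun t => (con c p.1, [t])

theorem strand_conL {c m : ℕ} {L : List ((ℕ × ℕ) × List ℕ)} (hc : ChordW m L)
    (hL : ∀ p ∈ L, ¬ tch p.1 c) (s : ℕ) :
    strand (conL c L) s = strand L (if s < c then s else s + 1) := by
  unfold strand conL
  rw [List.flatMap_assoc]
  apply List.flatMap_congr
  intro p hp
  have hp' := hc p hp
  rw [List.flatMap_map]
  simp only [tch_con (hL p hp) hp'.1 (by omega : 1 ≤ p.1.2) s]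
  by_cases h : tch p.1 (if s < c then s else s + 1)
  · simp only [h, if_true]; simp
  · simp only [h, if_false]; simp

theorem rd_conL {c m : ℕ} {L : List ((ℕ × ℕ) × List ℕ)} (hc : ChordW m L)
    (hL : ∀ p ∈ L, ¬ tch p.1 c) (h1 : 1 ≤ c) (h2 : c ≤ m) :
    rd (m - 1) (conL c L) = rd m L := by
  obtain ⟨a, rfl⟩ : ∃ a, c = a + 1 := ⟨c - 1, by omega⟩
  obtain ⟨d, rfl⟩ : ∃ d, m = a + (1 + d) := ⟨m - (a + 1), by omega⟩
  have e : a + (1 + d) - 1 = a + d := by omega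
  rw [e]
  unfold rd
  simp only [List.range_add, List.flatMap_append, List.map_append, List.flatMap_map, List.map_map,
    List.range_one, strand_conL hc hL]
  have h0 : strand L (a + 1) = [] := by
    unfold strand
    rw [List.flatMap_eq_nil_iff]
    intro p hp
    simp [hL p hp]
  congr 1
  · apply List.flatMap_congr
    intro s hs
    rw [List.mem_range] at hs
    rw [if_pos (by omega)]
  · simp only [List.map_cons, List.map_nil, List.flatMap_cons, List.flatMap_nil, Nat.add_zero, h0,
      List.nil_append]
    apply List.flatMap_congr
    intro s hs
    rw [if_neg (by omega)]
    simp only [Function.comp]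
    congr 1
    omega

theorem Inv.touched {n m : ℕ} {W : List (ℕ × ℕ)} {D : List ℕ} {L : List ((ℕ × ℕ) × List ℕ)}
    (h : Inv n m W D L) (hmin : m = braidIndex n D) (hm : 2 ≤ m) {c : ℕ} (h1 : 1 ≤ c)
    (h2 : c ≤ m) : ∃ p ∈ L, tch p.1 c := by
  by_contra hno
  push Not at hno
  have hc : ChordW (m - 1) (conL c L) := by
    intro p hp
    unfold conL at hp
    simp only [List.mem_flatMap, List.mem_map] at hp
    obtain ⟨q, hq, t, ht, rfl⟩ := hp
    have hq1 := h.chord q hq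
    have hq2 := hno q hq
    unfold tch at hq2
    unfold con
    dsimp only
    split_ifs <;> omega
  have hcw : IsChordWord (m - 1) ((conL c L).map (·.1)) := by
    intro p hp
    obtain ⟨q, hq, rfl⟩ := List.mem_map.1 hp
    exact hc q hq
  have hlabs : labs (conL c L) = labs L := by
    unfold labs conL
    rw [List.flatMap_assoc]
    apply List.flatMap_congr
    intro p hp
    rw [List.flatMap_map]
    simp
  have hsd : SameDiagram n (blowUp (wts (conL c L)) (standardName (m - 1) ((conL c L).map (·.1)))) D := by
    apply blow_same
    · rw [hlabs]; exact h.perm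
    · rw [rd_conL h.chord hno h1 h2]; exact h.rot
  rw [blowUp_one _ hcw] at hsd
  · have hle : braidIndex n D ≤ m - 1 := Nat.sInf_le ⟨by omega, _, hcw, hsd⟩
    omega
  · intro r hr1 hr2
    rw [List.length_map] at hr2
    have hr : r - 1 < (conL c L).length := by omega
    have hmem := List.getElem_mem hr
    unfold wts
    rw [List.getD_eq_getElem _ _ hr]
    generalize (conL c L)[r - 1] = q at hmem
    unfold conL at hmem
    simp only [List.mem_flatMap, List.mem_map] at hmem
    obtain ⟨q', hq, t, ht, rfl⟩ := hmem
    rfl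

/-- The next strand cyclically. -/
def nxt (m a : ℕ) : ℕ := if a < m then a + 1 else 1

theorem tch_shift_nxt {m : ℕ} {g : ℕ × ℕ} (hg : 1 ≤ g.1 ∧ g.1 < g.2 ∧ g.2 ≤ m) {a : ℕ}
    (ha : a ≤ m) (ha1 : 1 ≤ a) : tch (shift m g) (nxt m a) ↔ tch g a := by
  unfold nxt
  split_ifs with h
  · exact tch_shift hg h ha1
  · have : a = m := by omega
    rw [this]; exact tch_shift_top hg

/-- The destabilization obstruction. -/
theorem Inv.no_destab {n m : ℕ} {W : List (ℕ × ℕ)} {D : List ℕ} {U V : List ((ℕ × ℕ) × List ℕ)}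
    (h : Inv n m W D (U ++ V)) (hmin : m = braidIndex n D) (hm : 2 ≤ m) {a : ℕ} (h1 : 1 ≤ a)
    (h2 : a ≤ m) (hU : ∀ p ∈ U, ¬ tch p.1 (nxt m a)) (hV : ∀ p ∈ V, ¬ tch p.1 a) : False := by
  have h' := h.cyc_suffix V
  obtain ⟨p, hp, hpt⟩ := h'.touched hmin hm (c := nxt m a) (by unfold nxt; split_ifs <;> omega)
    (by unfold nxt; split_ifs <;> omega)
  rw [List.mem_append] at hp
  rcases hp with hp | hp
  · obtain ⟨q, hq, rfl⟩ := List.mem_map.1 hp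
    rw [tch_shift_nxt (h.chord q (by simp [hq])) h2 h1] at hpt
    exact hV q hq hpt
  · exact hU p hp hpt

/-! ### Pairs -/

/-- The list of (strand, index) pairs in the order they are read. -/
def prs (m : ℕ) (W : List (ℕ × ℕ)) : List (ℕ × ℕ) :=
  (List.range m).flatMap fun s =>
    ((List.range W.length).filter
      (fun r => decide ((W.getD r (0, 0)).1 = s + 1 ∨ (W.getD r (0, 0)).2 = s + 1))).map
      (fun r => (s + 1, r))

theorem sn_prs (m : ℕ) (W : List (ℕ × ℕ)) :
    standardName m W = (prs m W).map (fun p => p.2 + 1) := by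
  unfold standardName prs
  rw [List.map_flatMap]
  simp only [List.map_map]
  rfl

def lx (p q : ℕ × ℕ) : Prop := p.1 < q.1 ∨ p.1 = q.1 ∧ p.2 < q.2

theorem mem_prs {m : ℕ} {W : List (ℕ × ℕ)} {u : ℕ × ℕ} :
    u ∈ prs m W ↔ 1 ≤ u.1 ∧ u.1 ≤ m ∧ u.2 < W.length ∧ tch (W.getD u.2 (0, 0)) u.1 := by
  unfold prs tch
  simp only [List.mem_flatMap, List.mem_range, List.mem_map, List.mem_filter, decide_eq_true_eq]
  constructor
  · rintro ⟨s, hs, r, ⟨hr, hr2⟩, rfl⟩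
    exact ⟨by simp, by simp; omega, hr, hr2⟩
  · rintro ⟨h1, h2, h3, h4⟩
    have e : u.1 - 1 + 1 = u.1 := by omega
    refine ⟨u.1 - 1, by omega, u.2, ⟨h3, ?_⟩, ?_⟩
    · rw [e]; exact h4
    · rw [e]

theorem prs_pairwise (m : ℕ) (W : List (ℕ × ℕ)) : (prs m W).Pairwise lx := by
  unfold prs
  rw [List.pairwise_flatMap]
  constructor
  · intro s _
    rw [List.pairwise_map]
    refine List.Pairwise.imp ?_ (List.Pairwise.filter _ List.pairwise_lt_range)
    intro a b hab
    exact Or.inr ⟨rfl, hab⟩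
  · refine List.Pairwise.imp ?_ List.pairwise_lt_range
    intro a b hab x hx y hy
    obtain ⟨r, _, rfl⟩ := List.mem_map.1 hx
    obtain ⟨r', _, rfl⟩ := List.mem_map.1 hy
    exact Or.inl (by simpa using hab)

theorem prs_nodup (m : ℕ) (W : List (ℕ × ℕ)) : (prs m W).Nodup := by
  refine List.Pairwise.imp ?_ (prs_pairwise m W)
  rintro a b hab rfl
  rcases hab with h | h
  · omega
  · omega

/-- Cyclic adjacency in a strictly sorted list. -/
theorem sorted_rot {l Q : List (ℕ × ℕ)} {u v : ℕ × ℕ} (hl : l.Pairwise lx)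
    (h : (u :: v :: Q).IsRotated l) :
    (lx u v ∧ ∀ z ∈ l, (z = u ∨ lx z u) ∨ (z = v ∨ lx v z)) ∨
    ((∀ z ∈ l, z = u ∨ lx z u) ∧ (∀ z ∈ l, z = v ∨ lx v z)) := by
  rw [List.isRotated_iff_mod] at h
  obtain ⟨k, hk, rfl⟩ := h
  rw [List.rotate_eq_drop_append_take hk] at *
  rcases k with _ | _ | k
  · left
    simp only [List.drop_zero, List.take_zero, List.append_nil, List.pairwise_cons,
      List.mem_cons] at hl ⊢
    refine ⟨hl.1 v (by simp), ?_⟩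
    rintro z (rfl | rfl | hz)
    · simp
    · simp
    · right; right; exact hl.2.1 z hz
  · right
    simp only [zero_add, List.drop_succ_cons, List.drop_zero, List.take_succ_cons, List.take_zero,
      List.cons_append, List.pairwise_cons, List.pairwise_append, List.mem_append, List.mem_cons,
      List.not_mem_nil, or_false] at hl ⊢
    constructor
    · rintro z (rfl | hz | rfl)
      · right; exact hl.1 u (by simp)
      · right; exact hl.2.2.2 z hz u rfl
      · simp
    · rintro z (rfl | hz | rfl)
      · simp
      · right; exact hl.1 z (by simp [hz])
      · right; exact hl.1 z (by simp)
  · left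
    simp only [List.drop_succ_cons, List.take_succ_cons, List.pairwise_cons, List.pairwise_append,
      List.mem_append, List.mem_cons] at hl ⊢
    obtain ⟨hl1, hl2, hl3⟩ := hl
    refine ⟨hl2.1 v (by simp), ?_⟩
    rintro z (hz | rfl | rfl | hz)
    · left; right; exact hl3 z hz u (by simp)
    · simp
    · simp
    · right; right; exact hl2.2.1 z hz

/-- Cyclic adjacency in terms of strands. -/
def Adj (m : ℕ) (W : List (ℕ × ℕ)) (a r a' s : ℕ) : Prop :=
  (a = a' ∧ r < s ∧ ∀ t, t < W.length → tch (W.getD t (0, 0)) a → t ≤ r ∨ s ≤ t) ∨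
  (a' = nxt m a ∧ (∀ t, t < W.length → tch (W.getD t (0, 0)) a → t ≤ r) ∧
    ∀ t, t < W.length → tch (W.getD t (0, 0)) a' → s ≤ t)

theorem adj_of_rot {m : ℕ} {W Q : List (ℕ × ℕ)} {u v : ℕ × ℕ}
    (hne : ∀ c, 1 ≤ c → c ≤ m → ∃ t, t < W.length ∧ tch (W.getD t (0, 0)) c)
    (h : (u :: v :: Q).IsRotated (prs m W)) : Adj m W u.1 u.2 v.1 v.2 := by
  have hu := mem_prs.1 ((h.perm.mem_iff (a := u)).1 (by simp))
  have hv := mem_prs.1 ((h.perm.mem_iff (a := v)).1 (by simp))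
  have key : ∀ c t, 1 ≤ c → c ≤ m → t < W.length → tch (W.getD t (0, 0)) c → (c, t) ∈ prs m W :=
    fun c t h1 h2 h3 h4 => mem_prs.2 ⟨h1, h2, h3, h4⟩
  have eqv : ∀ (c t : ℕ) (w : ℕ × ℕ), (c, t) = w → c = w.1 ∧ t = w.2 := by
    rintro c t w rfl; exact ⟨rfl, rfl⟩
  rcases sorted_rot (prs_pairwise m W) h with ⟨huv, hz⟩ | ⟨hz1, hz2⟩
  · have hz' : ∀ c t, 1 ≤ c → c ≤ m → t < W.length → tch (W.getD t (0, 0)) c →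
        (c < u.1 ∨ c = u.1 ∧ t ≤ u.2) ∨ (v.1 < c ∨ v.1 = c ∧ v.2 ≤ t) := by
      intro c t h1 h2 h3 h4
      rcases hz _ (key c t h1 h2 h3 h4) with (e | e) | (e | e)
      · have := eqv _ _ _ e; omega
      · simp only [lx] at e; omega
      · have := eqv _ _ _ e; omega
      · simp only [lx] at e; omega
    unfold lx at huv
    by_cases he : u.1 = v.1
    · left
      refine ⟨he, by omega, fun t ht htt => ?_⟩
      have := hz' _ t hu.1 hu.2.1 ht htt
      omega
    · right
      have hlt : u.1 < v.1 := by omega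
      refine ⟨?_, fun t ht htt => ?_, fun t ht htt => ?_⟩
      · obtain ⟨t, ht, htt⟩ := hne (u.1 + 1) (by omega) (by omega)
        have := hz' _ t (by omega) (by omega) ht htt
        unfold nxt
        rw [if_pos (by omega)]
        omega
      · have := hz' _ t hu.1 hu.2.1 ht htt
        omega
      · have := hz' _ t hv.1 hv.2.1 ht htt
        omega
  · have hz' : ∀ c t, 1 ≤ c → c ≤ m → t < W.length → tch (W.getD t (0, 0)) c →
        (c < u.1 ∨ c = u.1 ∧ t ≤ u.2) ∧ (v.1 < c ∨ v.1 = c ∧ v.2 ≤ t) := by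
      intro c t h1 h2 h3 h4
      constructor
      · rcases hz1 _ (key c t h1 h2 h3 h4) with e | e
        · have := eqv _ _ _ e; omega
        · simp only [lx] at e; omega
      · rcases hz2 _ (key c t h1 h2 h3 h4) with e | e
        · have := eqv _ _ _ e; omega
        · simp only [lx] at e; omega
    right
    refine ⟨?_, fun t ht htt => ?_, fun t ht htt => ?_⟩
    · obtain ⟨t, ht, htt⟩ := hne m (by omega) (by omega)
      have h1 := hz' _ t (by omega) (by omega) ht htt
      obtain ⟨t', ht', htt'⟩ := hne 1 (by omega) (by omega)
      have h2 := hz' _ t' (by omega) (by omega) ht' htt'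
      unfold nxt
      rw [if_neg (by omega)]
      omega
    · have := hz' _ t hu.1 hu.2.1 ht htt
      omega
    · have := hz' _ t hv.1 hv.2.1 ht htt
      omega

end BraidAux
namespace BraidAux

theorem split_two {α : Type*} (L : List α) {r s : ℕ} (hrs : r < s) (hs : s < L.length) :
    ∃ (A M B : List α) (p q : α), L = A ++ p :: (M ++ q :: B) ∧ L[r]? = some p ∧ L[s]? = some q ∧
      (∀ x ∈ A, ∃ t, t < r ∧ L[t]? = some x) ∧
      (∀ x ∈ M, ∃ t, r < t ∧ t < s ∧ L[t]? = some x) ∧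
      (∀ x ∈ B, ∃ t, s < t ∧ L[t]? = some x) := by
  refine ⟨L.take r, (L.drop (r + 1)).take (s - (r + 1)), L.drop (s + 1), L[r], L[s], ?_,
    List.getElem?_eq_getElem _, List.getElem?_eq_getElem _, ?_, ?_, ?_⟩
  · have h1 : L.drop (s + 1) = (L.drop (r + 1)).drop (s - (r + 1) + 1) := by
      rw [List.drop_drop]; congr 1; omega
    have h2 : L[s] = (L.drop (r + 1))[s - (r + 1)]'(by rw [List.length_drop]; omega) := by
      rw [List.getElem_drop]; congr 1; omega
    rw [h1, h2, ← List.drop_eq_getElem_cons, List.take_append_drop, ← List.drop_eq_getElem_cons,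
      List.take_append_drop]
  · intro x hx
    obtain ⟨t, ht, rfl⟩ := List.mem_iff_getElem.1 hx
    rw [List.length_take] at ht
    exact ⟨t, by omega, by rw [List.getElem_take, List.getElem?_eq_getElem (by omega)]⟩
  · intro x hx
    obtain ⟨t, ht, rfl⟩ := List.mem_iff_getElem.1 hx
    rw [List.length_take, List.length_drop] at ht
    exact ⟨r + 1 + t, by omega, by omega,
      by rw [List.getElem_take, List.getElem_drop, List.getElem?_eq_getElem (by omega)]⟩
  · intro x hx
    obtain ⟨t, ht, rfl⟩ := List.mem_iff_getElem.1 hx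
    rw [List.length_drop] at ht
    exact ⟨s + 1 + t, by omega,
      by rw [List.getElem_drop, List.getElem?_eq_getElem (by omega)]⟩

theorem getD_of {L : List ((ℕ × ℕ) × List ℕ)} {t : ℕ} {x : (ℕ × ℕ) × List ℕ}
    (h : L[t]? = some x) :
    t < (L.map (·.1)).length ∧ (L.map (·.1)).getD t (0, 0) = x.1 := by
  obtain ⟨h1, h2⟩ := List.getElem?_eq_some_iff.1 h
  refine ⟨by simpa using h1, ?_⟩
  rw [List.getD_eq_getElem _ _ (by simpa using h1), List.getElem_map, h2]

theorem tch_two {g : ℕ × ℕ} {a b s : ℕ} (ha : tch g a) (hb : tch g b) (hab : a ≠ b) :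
    tch g s ↔ s = a ∨ s = b := by
  unfold tch at *; omega

theorem gen_eq {g g' : ℕ × ℕ} {a b : ℕ} (ha : tch g a) (hb : tch g b) (hab : a ≠ b)
    (ha' : tch g' a) (hb' : tch g' b) (h : g.1 < g.2) (h' : g'.1 < g'.2) : g = g' := by
  unfold tch at *
  ext <;> omega

theorem reduce {n m : ℕ} {W : List (ℕ × ℕ)} {D : List ℕ} {L : List ((ℕ × ℕ) × List ℕ)}
    (h : Inv n m W D L) (hmin : m = braidIndex n D) (hm : 2 ≤ m) {a b a' b' r s : ℕ}
    (hab : a ≠ b) (hab' : a' ≠ b') (hrs : r ≠ s)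
    (har : (a, r) ∈ prs m (L.map (·.1))) (hbr : (b, r) ∈ prs m (L.map (·.1)))
    (has : (a', s) ∈ prs m (L.map (·.1))) (hbs : (b', s) ∈ prs m (L.map (·.1)))
    (h1 : Adj m (L.map (·.1)) a r a' s) (h2 : Adj m (L.map (·.1)) b r b' s) :
    ∃ L', Inv n m W D L' ∧ L'.length < L.length := by
  rw [mem_prs] at har hbr has hbs
  simp only at har hbr has hbs
  have hr : r < L.length := by simpa using har.2.2.1
  have hs : s < L.length := by simpa using has.2.2.1
  -- a crossing adjacency with `r < s` is impossible
  have cross : ∀ c c', 1 ≤ c → c ≤ m → r < s → (c' = nxt m c ∧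
      (∀ t, t < (L.map (·.1)).length → tch ((L.map (·.1)).getD t (0, 0)) c → t ≤ r) ∧
      ∀ t, t < (L.map (·.1)).length → tch ((L.map (·.1)).getD t (0, 0)) c' → s ≤ t) → False := by
    rintro c c' hc1 hc2 hlt ⟨rfl, hl, hf⟩
    obtain ⟨A, M, B, p, q, hL, hp, hq, hA, hM, hB⟩ := split_two L hlt hs
    have hL' : L = (A ++ p :: M) ++ (q :: B) := by rw [hL]; simp
    have h' := h
    rw [hL'] at h'
    refine h'.no_destab hmin hm hc1 hc2 ?_ ?_
    · intro x hx hxt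
      have : ∃ t, t < s ∧ L[t]? = some x := by
        rw [List.mem_append, List.mem_cons] at hx
        rcases hx with hx | rfl | hx
        · obtain ⟨t, ht, he⟩ := hA x hx; exact ⟨t, by omega, he⟩
        · exact ⟨r, hlt, hp⟩
        · obtain ⟨t, _, ht, he⟩ := hM x hx; exact ⟨t, ht, he⟩
      obtain ⟨t, ht, he⟩ := this
      obtain ⟨e1, e2⟩ := getD_of he
      have := hf t e1 (by rw [e2]; exact hxt)
      omega
    · intro x hx hxt
      have : ∃ t, s ≤ t ∧ L[t]? = some x := by
        rw [List.mem_cons] at hx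
        rcases hx with rfl | hx
        · exact ⟨s, le_rfl, hq⟩
        · obtain ⟨t, ht, he⟩ := hB x hx; exact ⟨t, by omega, he⟩
      obtain ⟨t, ht, he⟩ := this
      obtain ⟨e1, e2⟩ := getD_of he
      have := hl t e1 (by rw [e2]; exact hxt)
      omega
  rcases Nat.lt_or_gt_of_ne hrs with hlt | hgt
  · -- both adjacencies lie on a single strand
    rcases h1 with ⟨rfl, _, h1⟩ | h1
    swap
    · exact (cross a a' har.1 har.2.1 hlt h1).elim
    rcases h2 with ⟨rfl, _, h2⟩ | h2
    swap
    · exact (cross b b' hbr.1 hbr.2.1 hlt h2).elim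
    obtain ⟨A, M, B, ⟨g, l1⟩, ⟨g', l2⟩, hL, hp, hq, hA, hM, hB⟩ := split_two L hlt hs
    obtain ⟨_, ep⟩ := getD_of hp
    obtain ⟨_, eq⟩ := getD_of hq
    rw [ep] at har hbr
    rw [eq] at has hbs
    have hg := h.chord _ (List.mem_of_getElem? hp)
    have hg' := h.chord _ (List.mem_of_getElem? hq)
    have hgg : g = g' := gen_eq har.2.2.2 hbr.2.2.2 hab has.2.2.2 hbs.2.2.2 hg.2.1 hg'.2.1
    subst hgg
    have h' := h
    rw [hL] at h'
    have h3 := h'.comm_right M (by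
      intro q hqM z hz hz'
      obtain ⟨t, ht1, ht2, he⟩ := hM q hqM
      obtain ⟨e1, e2⟩ := getD_of he
      rcases (tch_two har.2.2.2 hbr.2.2.2 hab).1 hz with rfl | rfl
      · have := h1 t e1 (by rw [e2]; exact hz')
        omega
      · have := h2 t e1 (by rw [e2]; exact hz')
        omega)
    refine ⟨_, h3.merge, ?_⟩
    rw [hL]
    simp
  · -- both adjacencies cross
    rcases h1 with ⟨_, h1, _⟩ | ⟨rfl, hl1, hf1⟩
    · omega
    rcases h2 with ⟨_, h2, _⟩ | ⟨rfl, hl2, hf2⟩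
    · omega
    obtain ⟨A, M, B, ⟨g', l2⟩, ⟨g, l1⟩, hL, hq, hp, hA, hM, hB⟩ := split_two L hgt hr
    obtain ⟨_, ep⟩ := getD_of hp
    obtain ⟨_, eq⟩ := getD_of hq
    rw [ep] at har hbr
    rw [eq] at has hbs
    have hg := h.chord _ (List.mem_of_getElem? hp)
    have hg' := h.chord _ (List.mem_of_getElem? hq)
    have hL' : L = (A ++ (g', l2) :: M) ++ (g, l1) :: (B ++ []) := by rw [hL]; simp
    have h' := h
    rw [hL'] at h'
    have h3 := h'.comm_right B (by
      intro q hqB z hz hz'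
      obtain ⟨t, ht1, he⟩ := hB q hqB
      obtain ⟨e1, e2⟩ := getD_of he
      rcases (tch_two har.2.2.2 hbr.2.2.2 hab).1 hz with rfl | rfl
      · have := hl1 t e1 (by rw [e2]; exact hz')
        omega
      · have := hl2 t e1 (by rw [e2]; exact hz')
        omega)
    have h4 := h3.cyc
    have hsg := (h4.chord _ (List.mem_cons_self)).2.1
    have ta := (tch_shift_nxt hg har.2.1 har.1).2 har.2.2.2
    have tb := (tch_shift_nxt hg hbr.2.1 hbr.1).2 hbr.2.2.2
    have hgg : shift m g = g' := gen_eq ta tb hab' has.2.2.2 hbs.2.2.2 hsg hg'.2.1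
    simp only [hgg] at h4
    have h5 : Inv n m W D ([] ++ (g', l1) :: (A ++ (g', l2) :: (M ++ B))) := by simpa using h4
    have h6 := h5.comm_right A (by
      intro q hqA z hz hz'
      obtain ⟨t, ht1, he⟩ := hA q hqA
      obtain ⟨e1, e2⟩ := getD_of he
      rcases (tch_two has.2.2.2 hbs.2.2.2 hab').1 hz with rfl | rfl
      · have := hf1 t e1 (by rw [e2]; exact hz')
        omega
      · have := hf2 t e1 (by rw [e2]; exact hz')
        omega)
    refine ⟨_, h6.merge, ?_⟩
    rw [hL]
    simp

theorem flat_eq_power (L : List ((ℕ × ℕ) × List ℕ)) :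
    powerWord (wts L) (L.map (·.1)) = flat L := by
  unfold powerWord flat
  conv_rhs => rw [← map_range_getD L ((0, 0), [])]
  rw [List.flatMap_map, List.length_map]
  apply List.flatMap_congr
  intro r hr
  rw [List.mem_range] at hr
  simp [wts, hr]

theorem amalg_or_reduce {n m : ℕ} {W : List (ℕ × ℕ)} {D : List ℕ} {L : List ((ℕ × ℕ) × List ℕ)}
    (h : Inv n m W D L) (hmin : m = braidIndex n D)
    (hno : ¬ ∃ L', Inv n m W D L' ∧ L'.length < L.length) :
    Amalgamated (L.map (·.1)).length (standardName m (L.map (·.1))) := by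
  rintro ⟨x, y, U, V, hxy, k, σ, -, hM⟩
  apply hno
  rw [sn_prs, ← List.map_rotate, List.map_map] at hM
  have hM := hM.symm
  rw [List.map_eq_cons_iff] at hM
  obtain ⟨u, l1, e1, hu, hM⟩ := hM
  rw [List.map_eq_cons_iff] at hM
  obtain ⟨v, l2, rfl, hv, hM⟩ := hM
  rw [List.map_eq_append_iff] at hM
  obtain ⟨U', l3, rfl, -, hM⟩ := hM
  rw [List.map_eq_cons_iff] at hM
  obtain ⟨u', l4, rfl, hu', hM⟩ := hM
  rw [List.map_eq_cons_iff] at hM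
  obtain ⟨v', V', rfl, hv', -⟩ := hM
  simp only [Function.comp] at hu hv hu' hv'
  have er : u'.2 = u.2 := by
    have := σ.injective (hu'.trans hu.symm); omega
  have es : v'.2 = v.2 := by
    have := σ.injective (hv'.trans hv.symm); omega
  have hrs : u.2 ≠ v.2 := by
    intro e; apply hxy; rw [← hu, ← hv, e]
  have rot1 : (u :: v :: (U' ++ u' :: v' :: V')).IsRotated (prs m (L.map (·.1))) := by
    rw [← e1]; exact List.IsRotated.symm ⟨k, rfl⟩
  have rot2 : (u' :: v' :: (V' ++ u :: v :: U')).IsRotated (prs m (L.map (·.1))) := by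
    refine List.IsRotated.trans ?_ rot1
    have := List.isRotated_append (l := u' :: v' :: V') (l' := u :: v :: U')
    simpa using this
  have hnd : (u :: v :: (U' ++ u' :: v' :: V')).Nodup :=
    rot1.nodup_iff.2 (prs_nodup _ _)
  have mem : ∀ z ∈ (u :: v :: (U' ++ u' :: v' :: V')), z ∈ prs m (L.map (·.1)) :=
    fun z hz => rot1.perm.mem_iff.1 hz
  have huu : u ≠ u' := by
    rintro rfl; simp at hnd
  have hvv : v ≠ v' := by
    rintro rfl; simp at hnd
  have hab : u.1 ≠ u'.1 := fun e => huu (Prod.ext e er.symm)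
  have hab' : v.1 ≠ v'.1 := fun e => hvv (Prod.ext e es.symm)
  have mu := mem u (by simp)
  have mu' := mem u' (by simp)
  have mv := mem v (by simp)
  have mv' := mem v' (by simp)
  have hm : 2 ≤ m := by
    have h1 := mem_prs.1 mu
    have h2 := mem_prs.1 mu'
    omega
  have hne : ∀ c, 1 ≤ c → c ≤ m →
      ∃ t, t < (L.map (·.1)).length ∧ tch ((L.map (·.1)).getD t (0, 0)) c := by
    intro c h1 h2
    obtain ⟨p, hp, hpc⟩ := h.touched hmin hm h1 h2
    obtain ⟨t, ht⟩ := List.mem_iff_getElem?.1 hp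
    obtain ⟨e1, e2⟩ := getD_of ht
    exact ⟨t, e1, by rw [e2]; exact hpc⟩
  have a1 := adj_of_rot hne rot1
  have a2 := adj_of_rot hne rot2
  rw [er, es] at a2
  refine reduce h hmin hm hab hab' hrs mu ?_ mv ?_ a1 a2
  · rw [← er]; exact mu'
  · rw [← es]; exact mv'

theorem exists_inv {n m : ℕ} {W : List (ℕ × ℕ)} {D : List ℕ} (hD : IsName n D)
    (hW : IsBraiding n m W D) : ∃ L, Inv n m W D L := by
  obtain ⟨hc, k, σ, hσ, hk⟩ := hW
  have hlen : W.length = n := by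
    have h1 := (sn_isName hc).1
    have h2 := hD.1
    rw [hk, List.length_map, List.length_rotate] at h2
    omega
  refine ⟨sing W σ, chord_sing hc _, ?_, ?_, ?_, ?_⟩
  · intro p hp
    obtain ⟨i, _, rfl⟩ := List.mem_map.1 hp
    simp
  · rw [flat_sing]; exact Relation.ReflTransGen.refl
  · rw [labs_sing, hlen]
    have hnd : ((List.range' 1 n).map σ).Nodup := List.Nodup.map σ.injective List.nodup_range'
    refine (List.subperm_of_subset hnd ?_).perm_of_length_le (by simp)
    intro x hx
    obtain ⟨y, hy, rfl⟩ := List.mem_map.1 hx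
    rw [List.mem_range'_1] at *
    have := hσ y (by omega) (by omega)
    omega
  · rw [rd_sing, hk, List.map_rotate]
    exact ⟨k, rfl⟩

theorem exists_min_inv {n m : ℕ} {W : List (ℕ × ℕ)} {D : List ℕ} (hD : IsName n D)
    (hW : IsBraiding n m W D) : ∃ L, Inv n m W D L ∧
      ¬ ∃ L', Inv n m W D L' ∧ L'.length < L.length := by
  obtain ⟨L0, hL0⟩ := exists_inv hD hW
  have key : ∀ (k : ℕ) (L : List ((ℕ × ℕ) × List ℕ)), L.length ≤ k → Inv n m W D L →
      ∃ L, Inv n m W D L ∧ ¬ ∃ L', Inv n m W D L' ∧ L'.length < L.length := by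
    intro k
    induction k with
    | zero => exact fun L hk hL => ⟨L, hL, fun ⟨L', _, hlt⟩ => by omega⟩
    | succ k ih =>
      intro L hk hL
      by_cases hc : ∃ L', Inv n m W D L' ∧ L'.length < L.length
      · obtain ⟨L', hL', hlt⟩ := hc
        exact ih L' (by omega) hL'
      · exact ⟨L, hL, hc⟩
  exact key _ L0 le_rfl hL0

end BraidAux

/-- A minimum braid index representative `W` of a diagram `D` is
related, by commutation and cyclic permutation moves, to a chord word of the form
`A(i_1,j_1)^{w_1} ⋯ A(i_k,j_k)^{w_k}` where `W_a = A(i_1,j_1) ⋯ A(i_k,j_k)` is a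
braiding of an amalgamated diagram and the blow-up of the standard name of `W_a` with
weights `w_1, …, w_k` is a name of `D`. -/
theorem minimal_braiding_powerWord (n m : ℕ) (D : List ℕ) (hD : IsName n D)
    (W : List (ℕ × ℕ)) (hW : IsBraiding n m W D) (hmin : m = braidIndex n D) :
    ∃ (Wa : List (ℕ × ℕ)) (w : ℕ → ℕ),
      (∀ r, 1 ≤ r → r ≤ Wa.length → 1 ≤ w r) ∧
      CCEquiv m W (powerWord w Wa) ∧
      IsChordWord m Wa ∧
      IsName Wa.length (standardName m Wa) ∧
      Amalgamated Wa.length (standardName m Wa) ∧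
      IsName n (blowUp w (standardName m Wa)) ∧
      SameDiagram n (blowUp w (standardName m Wa)) D := by
  obtain ⟨L, hL, hLmin⟩ : ∃ L, BraidAux.Inv n m W D L ∧
      ¬ ∃ L', BraidAux.Inv n m W D L' ∧ L'.length < L.length := by
    exact BraidAux.exists_min_inv hD hW
  have hcw : IsChordWord m (L.map (·.1)) := by
    intro p hp
    obtain ⟨q, hq, rfl⟩ := List.mem_map.1 hp
    exact hL.chord q hq
  have hsame := BraidAux.blow_same hL.perm hL.rot
  have hname := BraidAux.SameDiagram.isName hsame hD
  have hamal := BraidAux.amalg_or_reduce hL hmin hLmin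
  have hsn := BraidAux.sn_isName hcw
  have hw : ∀ r, 1 ≤ r → r ≤ (L.map (·.1)).length → 1 ≤ BraidAux.wts L r := by
    intro r h1 h2
    rw [List.length_map] at h2
    have hr : r - 1 < L.length := by omega
    unfold BraidAux.wts
    rw [List.getD_eq_getElem _ _ hr]
    exact hL.ne _ (List.getElem_mem hr)
  have hcc : CCEquiv m W (powerWord (BraidAux.wts L) (L.map (·.1))) := by
    rw [BraidAux.flat_eq_power]
    exact hL.cc
  generalize L.map (·.1) = Wa at hcw hsame hname hamal hsn hw hcc
  generalize BraidAux.wts L = w at hsame hname hw hcc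
  exact ⟨Wa, w, hw, hcc, hcw, hsn, hamal, hname, hsame⟩
end

section
/- Let E be an amalgamated n-diagram and let D be the diagram represented by the blow-up of a name of E with weights w_1,...,w_n ≥ 1. Then the braid indices of D and E are equal: b(D) = b(E). -/
/-- Label-free reformulation of braidability on `m` strands: `L` lists the chords in order,
each with its label and its two strands. -/
def Br (m : ℕ) (N : List ℕ) : Prop :=
  ∃ L : List (ℕ × ℕ × ℕ), (L.map Prod.fst).Nodup ∧
    (∀ t ∈ L, 1 ≤ t.2.1 ∧ t.2.1 < t.2.2 ∧ t.2.2 ≤ m) ∧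
    N ~r ((List.range m).flatMap fun s =>
      (L.filter fun t => decide (t.2.1 = s + 1 ∨ t.2.2 = s + 1)).map Prod.fst)

theorem Br_of_braiding {n m : ℕ} {W : List (ℕ × ℕ)} {N : List ℕ}
    (h : IsBraiding n m W N) : Br m N := by
  obtain ⟨hW, k, σ, -, rfl⟩ := h
  refine ⟨(List.range W.length).map (fun r => (σ (r + 1), W.getD r (0, 0))), ?_, ?_, ?_⟩
  · rw [List.map_map]
    refine List.Nodup.map ?_ List.nodup_range
    intro a b hab
    simpa using hab
  · intro t ht
    simp only [List.mem_map, List.mem_range] at ht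
    obtain ⟨r, hr, rfl⟩ := ht
    apply hW
    simp only
    rw [List.getD_eq_getElem _ _ hr]
    exact List.getElem_mem _
  · have : ((List.range m).flatMap fun s =>
      (((List.range W.length).map (fun r => (σ (r + 1), W.getD r (0, 0)))).filter
        fun t => decide (t.2.1 = s + 1 ∨ t.2.2 = s + 1)).map Prod.fst)
        = (standardName m W).map σ := by
      unfold standardName
      rw [List.map_flatMap]
      congr 1
      funext s
      rw [List.filter_map, List.map_map, List.map_map]
      rfl
    rw [this, List.map_rotate]
    exact (List.IsRotated.symm ⟨k, rfl⟩)

theorem mem_of_Br {m : ℕ} {N : List ℕ} {L : List (ℕ × ℕ × ℕ)}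
    (h2 : ∀ t ∈ L, 1 ≤ t.2.1 ∧ t.2.1 < t.2.2 ∧ t.2.2 ≤ m)
    (h3 : N ~r ((List.range m).flatMap fun s =>
      (L.filter fun t => decide (t.2.1 = s + 1 ∨ t.2.2 = s + 1)).map Prod.fst)) (x : ℕ) :
    x ∈ L.map Prod.fst ↔ x ∈ N := by
  rw [h3.mem_iff]
  simp only [List.mem_flatMap, List.mem_map, List.mem_filter, List.mem_range, decide_eq_true_eq]
  constructor
  · rintro ⟨t, ht, rfl⟩
    have := h2 t ht
    exact ⟨t.2.1 - 1, by omega, t, ⟨ht, by omega⟩, rfl⟩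
  · rintro ⟨s, hs, t, ⟨ht, -⟩, rfl⟩
    exact ⟨t, ht, rfl⟩

theorem exists_perm {n : ℕ} {l : List ℕ} (hn : l.Nodup) (hm : ∀ x, x ∈ l ↔ 1 ≤ x ∧ x ≤ n) :
    ∃ σ : Equiv.Perm ℕ, (∀ x, 1 ≤ x → x ≤ n → 1 ≤ σ x ∧ σ x ≤ n) ∧
      ∀ r, (h : r < l.length) → σ (r + 1) = l[r] := by
  have hlen : l.length = n := by
    rw [← List.toFinset_card_of_nodup hn]
    have : l.toFinset = Finset.Icc 1 n := by
      ext x; simp [hm]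
    rw [this]; simp
  let f : ℕ → ℕ := fun x => if 1 ≤ x ∧ x ≤ n then l.getD (x - 1) 0 else x
  have hf1 : ∀ x, (h1 : 1 ≤ x) → (h2 : x ≤ n) → f x = l[x - 1] := by
    intro x h1 h2
    simp only [f, if_pos (And.intro h1 h2)]
    rw [List.getD_eq_getElem]
  have hf2 : ∀ x, ¬ (1 ≤ x ∧ x ≤ n) → f x = x := by
    intro x h1
    simp only [f, if_neg h1]
  have hf3 : ∀ x, 1 ≤ x → x ≤ n → 1 ≤ f x ∧ f x ≤ n := by
    intro x h1 h2
    rw [hf1 x h1 h2, ← hm]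
    exact List.getElem_mem _
  have hbij : Function.Bijective f := by
    constructor
    · intro a b hab
      by_cases ha : 1 ≤ a ∧ a ≤ n <;> by_cases hb : 1 ≤ b ∧ b ≤ n
      · rw [hf1 a ha.1 ha.2, hf1 b hb.1 hb.2] at hab
        have := (List.Nodup.getElem_inj_iff hn).1 hab
        omega
      · have := hf3 a ha.1 ha.2
        rw [hab, hf2 b hb] at this
        exact absurd this hb
      · have := hf3 b hb.1 hb.2
        rw [← hab, hf2 a ha] at this
        exact absurd this ha
      · rwa [hf2 a ha, hf2 b hb] at hab
    · intro y
      by_cases hy : 1 ≤ y ∧ y ≤ n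
      · obtain ⟨i, hi, rfl⟩ := List.getElem_of_mem ((hm y).2 hy)
        refine ⟨i + 1, ?_⟩
        rw [hf1 (i + 1) (by omega) (by omega)]
        simp
      · exact ⟨y, hf2 y hy⟩
  refine ⟨Equiv.ofBijective f hbij, hf3, ?_⟩
  intro r hr
  have := hf1 (r + 1) (by omega) (by omega)
  simpa using this

theorem braiding_of_Br {n m : ℕ} {N : List ℕ} (hN : ∀ x, x ∈ N ↔ 1 ≤ x ∧ x ≤ n)
    (h : Br m N) : ∃ W, IsBraiding n m W N := by
  obtain ⟨L, h1, h2, h3⟩ := h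
  obtain ⟨σ, hσ, hσL⟩ := exists_perm h1 (fun x => (mem_of_Br h2 h3 x).trans (hN x))
  refine ⟨L.map Prod.snd, ?_, ?_⟩
  · intro p hp
    obtain ⟨t, ht, rfl⟩ := List.mem_map.1 hp
    exact h2 t ht
  · have hL : L = (List.range L.length).map
        (fun r => (σ (r + 1), (L.map Prod.snd).getD r (0, 0))) := by
      apply List.ext_getElem
      · simp
      · intro i hi hi'
        have := hσL i (by simpa using hi)
        simp only [List.getElem_map, List.getElem_range, this]
        rw [List.getD_eq_getElem _ _ (by simpa using hi)]
        simp
    have key : ((List.range m).flatMap fun s =>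
      (L.filter fun t => decide (t.2.1 = s + 1 ∨ t.2.2 = s + 1)).map Prod.fst)
        = (standardName m (L.map Prod.snd)).map σ := by
      unfold standardName
      rw [List.map_flatMap]
      congr 1
      funext s
      conv_lhs => rw [hL]
      rw [List.filter_map, List.map_map, List.map_map, List.length_map]
      rfl
    rw [key] at h3
    obtain ⟨k, hk⟩ := h3.symm
    exact ⟨k, σ, hσ, by rw [← hk, List.map_rotate]⟩

theorem isRotated_flatMap {α β : Type*} {l l' : List α} (f : α → List β) (h : l ~r l') :
    l.flatMap f ~r l'.flatMap f := by
  obtain ⟨k, rfl⟩ := h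
  rw [List.rotate_eq_drop_append_take_mod]
  conv_lhs => rw [← List.take_append_drop (k % l.length) l]
  rw [List.flatMap_append, List.flatMap_append]
  exact List.isRotated_append

theorem filter_map_flatMap (s : ℕ) (c : ℕ → List ℕ) (L : List (ℕ × ℕ × ℕ)) :
    ((L.flatMap fun t => (c t.1).map fun x => (x, t.2)).filter
      fun t => decide (t.2.1 = s + 1 ∨ t.2.2 = s + 1)).map Prod.fst
    = ((L.filter fun t => decide (t.2.1 = s + 1 ∨ t.2.2 = s + 1)).map Prod.fst).flatMap c := by
  induction L with
  | nil => rfl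
  | cons t L ih =>
    rw [List.flatMap_cons, List.filter_append, List.map_append, ih, List.filter_cons]
    by_cases h : (t.2.1 = s + 1 ∨ t.2.2 = s + 1)
    · rw [if_pos (by simpa using h), List.map_cons, List.flatMap_cons]
      congr 1
      rw [List.filter_map, List.map_map, List.filter_eq_self.2]
      · exact List.map_id _
      · intro a _
        simpa using h
    · rw [if_neg (by simpa using h), List.filter_map, List.filter_eq_nil_iff.2]
      · simp
      · intro a _
        simpa using h

/-- Replacing every label by a list of labels, pairwise disjoint, preserves braidability. -/
theorem Br_flatMap {m : ℕ} {N : List ℕ} (c : ℕ → List ℕ) (hc : ∀ x, (c x).Nodup)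
    (hd : ∀ x ∈ N, ∀ y ∈ N, ∀ z, z ∈ c x → z ∈ c y → x = y) (h : Br m N) :
    Br m (N.flatMap c) := by
  obtain ⟨L, h1, h2, h3⟩ := h
  refine ⟨L.flatMap fun t => (c t.1).map fun x => (x, t.2), ?_, ?_, ?_⟩
  · have : (L.flatMap fun t => (c t.1).map fun x => (x, t.2)).map Prod.fst
        = (L.map Prod.fst).flatMap c := by
      rw [List.map_flatMap, List.flatMap_map]
      congr 1
      funext t
      rw [List.map_map]
      exact List.map_id _
    rw [this, List.nodup_flatMap]
    refine ⟨fun x _ => hc x, ?_⟩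
    refine List.Pairwise.imp_of_mem ?_ h1
    intro a b ha hb hab z hza hzb
    exact hab (hd a ((mem_of_Br h2 h3 a).1 ha) b ((mem_of_Br h2 h3 b).1 hb) z hza hzb)
  · intro t ht
    simp only [List.mem_flatMap, List.mem_map] at ht
    obtain ⟨t', ht', x, -, rfl⟩ := ht
    exact h2 t' ht'
  · have := isRotated_flatMap c h3
    rw [List.flatMap_assoc] at this
    simp only [filter_map_flatMap]
    exact this

theorem mem_name {n : ℕ} {E : List ℕ} (hE : IsName n E) (x : ℕ) :
    x ∈ E ↔ 1 ≤ x ∧ x ≤ n := by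
  have h : 2 • (Finset.Icc 1 n).val = (E : Multiset ℕ) := by
    apply Multiset.eq_of_le_of_card_le
    · rw [Multiset.le_iff_count]
      intro a
      rw [Multiset.count_nsmul, Multiset.coe_count]
      by_cases ha : a ∈ Finset.Icc 1 n
      · have h' := Finset.mem_Icc.1 ha
        rw [hE.2 a h'.1 h'.2]
        have := Multiset.nodup_iff_count_le_one.1 (Finset.Icc 1 n).nodup a
        omega
      · rw [Multiset.count_eq_zero_of_notMem (by simpa using ha)]
        simp
    · simp [hE.1]
  rw [← Multiset.mem_coe, ← h, Multiset.mem_nsmul_of_ne_zero (by norm_num)]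
  simp

theorem S_le (w : ℕ → ℕ) {r r' : ℕ} (h1 : 1 ≤ r) (h : r < r') :
    (∑ s ∈ Finset.Ico 1 r, w s) + w r ≤ ∑ s ∈ Finset.Ico 1 r', w s := by
  rw [← Finset.sum_Ico_succ_top h1]
  exact Finset.sum_le_sum_of_subset (Finset.Ico_subset_Ico le_rfl h)

theorem S_inj (w : ℕ → ℕ) {r r' t t' : ℕ} (h1 : 1 ≤ r) (h1' : 1 ≤ r') (ht : t < w r)
    (ht' : t' < w r')
    (h : (∑ s ∈ Finset.Ico 1 r, w s) + t + 1 = (∑ s ∈ Finset.Ico 1 r', w s) + t' + 1) :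
    r = r' := by
  rcases lt_trichotomy r r' with hlt | heq | hlt
  · have := S_le w h1 hlt
    omega
  · exact heq
  · have := S_le w h1' hlt
    omega

theorem S_exists (w : ℕ → ℕ) (n x : ℕ) (h1 : 1 ≤ x) (h2 : x ≤ ∑ s ∈ Finset.Icc 1 n, w s) :
    ∃ r t, 1 ≤ r ∧ r ≤ n ∧ t < w r ∧ (∑ s ∈ Finset.Ico 1 r, w s) + t + 1 = x := by
  induction n with
  | zero => simp at h2; omega
  | succ n ih =>
    by_cases hx : x ≤ ∑ s ∈ Finset.Icc 1 n, w s
    · obtain ⟨r, t, a, b, c, d⟩ := ih hx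
      exact ⟨r, t, a, by omega, c, d⟩
    · rw [Finset.sum_Icc_succ_top (by omega)] at h2
      have e : Finset.Ico 1 (n + 1) = Finset.Icc 1 n := by
        ext a; simp only [Finset.mem_Ico, Finset.mem_Icc]; omega
      refine ⟨n + 1, x - 1 - ∑ s ∈ Finset.Icc 1 n, w s, by omega, le_rfl, by omega, ?_⟩
      rw [e]
      omega

theorem mem_blowUp {n : ℕ} {E : List ℕ} (hE : IsName n E) (w : ℕ → ℕ) (x : ℕ) :
    x ∈ blowUp w E ↔ 1 ≤ x ∧ x ≤ ∑ r ∈ Finset.Icc 1 n, w r := by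
  unfold blowUp
  simp only [List.mem_flatMap, List.mem_map, List.mem_range, mem_name hE]
  constructor
  · rintro ⟨r, ⟨h1, h2⟩, t, ht, rfl⟩
    have := S_le w h1 (Nat.lt_succ_of_le h2)
    have e : Finset.Ico 1 (n + 1) = Finset.Icc 1 n := by
      ext a; simp only [Finset.mem_Ico, Finset.mem_Icc]; omega
    rw [Nat.succ_eq_add_one, e] at this
    omega
  · rintro ⟨h1, h2⟩
    obtain ⟨r, t, a, b, c, d⟩ := S_exists w n x h1 h2
    exact ⟨r, ⟨a, b⟩, t, c, d⟩

theorem Br_blowUp_iff {n : ℕ} {E : List ℕ} (hE : IsName n E)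
    (w : ℕ → ℕ) (hw : ∀ r, 1 ≤ r → r ≤ n → 1 ≤ w r) (m : ℕ) :
    Br m (blowUp w E) ↔ Br m E := by
  constructor
  · intro h
    let c : ℕ → List ℕ := fun x =>
      (List.range' 1 n).filter fun r => decide (x = (∑ s ∈ Finset.Ico 1 r, w s) + 1)
    have hc : ∀ x, (c x).Nodup := fun x => (List.nodup_range' (step := 1)).filter _
    have hmem : ∀ x r, r ∈ c x ↔
        (1 ≤ r ∧ r ≤ n) ∧ x = (∑ s ∈ Finset.Ico 1 r, w s) + 1 := by
      intro x r
      simp only [c, List.mem_filter, List.mem_range'_1, decide_eq_true_eq]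
      omega
    have key := Br_flatMap c hc (fun x _ y _ z hx hy => by
      rw [hmem] at hx hy
      rw [hx.2, hy.2]) h
    have e : (blowUp w E).flatMap c = E := by
      unfold blowUp
      rw [List.flatMap_assoc]
      conv_rhs => rw [← List.flatMap_singleton' E]
      apply List.flatMap_congr
      intro r hr
      have hr' := (mem_name hE r).1 hr
      have hwr := hw r hr'.1 hr'.2
      have hz : ∀ t, t < w r → ∀ z, z ∈ c ((∑ s ∈ Finset.Ico 1 r, w s) + t + 1) →
          z = r ∧ t = 0 := by
        intro t ht z hz
        rw [hmem] at hz
        have : r = z := S_inj w hr'.1 hz.1.1 (t' := 0) ht (hw z hz.1.1 hz.1.2) hz.2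
        subst this
        exact ⟨rfl, by omega⟩
      obtain ⟨v, hv⟩ : ∃ v, w r = v + 1 := ⟨w r - 1, by omega⟩
      rw [hv, List.range_succ_eq_map, List.map_cons, List.flatMap_cons]
      have e1 : c ((∑ s ∈ Finset.Ico 1 r, w s) + 0 + 1) = [r] := by
        have hp : (c ((∑ s ∈ Finset.Ico 1 r, w s) + 0 + 1)).Perm [r] := by
          rw [List.perm_ext_iff_of_nodup (hc _) (List.nodup_singleton r)]
          intro z
          rw [List.mem_singleton]
          constructor
          · intro h
            exact (hz 0 (by omega) z h).1
          · rintro rfl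
            rw [hmem]
            exact ⟨hr', rfl⟩
        exact List.perm_singleton.1 hp
      rw [e1]
      have e2 : ∀ l : List ℕ, (∀ x ∈ l, c x = []) → l.flatMap c = [] := by
        intro l hl
        exact List.flatMap_eq_nil_iff.2 hl
      rw [e2, List.append_nil]
      intro x hx
      simp only [List.mem_map, List.mem_range] at hx
      obtain ⟨t, ⟨t', ht', rfl⟩, rfl⟩ := hx
      rw [List.eq_nil_iff_forall_not_mem]
      intro z hzm
      have := (hz (t' + 1) (by omega) z hzm).2
      omega
    rwa [e] at key
  · intro h
    refine Br_flatMap _ ?_ ?_ h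
    · intro r
      refine List.Nodup.map ?_ List.nodup_range
      intro a b hab
      simpa using hab
    · intro x hx y hy z hzx hzy
      simp only [List.mem_map, List.mem_range] at hzx hzy
      obtain ⟨t, ht, rfl⟩ := hzx
      obtain ⟨t', ht', h'⟩ := hzy
      exact S_inj w ((mem_name hE x).1 hx).1 ((mem_name hE y).1 hy).1 ht ht' h'.symm

/-- If `E` is an amalgamated `n`-diagram and `D` is the diagram
represented by the blow-up of a name of `E` with weights `w_1, …, w_n ≥ 1`, then
`b(D) = b(E)`. -/
theorem braidIndex_blowUp (n : ℕ) (E : List ℕ) (hE : IsName n E)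
    (hamal : Amalgamated n E)
    (w : ℕ → ℕ) (hw : ∀ r, 1 ≤ r → r ≤ n → 1 ≤ w r) :
    braidIndex (∑ r ∈ Finset.Icc 1 n, w r) (blowUp w E) = braidIndex n E := by
  unfold braidIndex
  congr 1
  ext m
  simp only [Set.mem_setOf_eq]
  refine and_congr_right fun _ => ?_
  constructor
  · rintro ⟨W, hW⟩
    exact braiding_of_Br (mem_name hE) ((Br_blowUp_iff hE w hw m).1 (Br_of_braiding hW))
  · rintro ⟨W, hW⟩
    exact braiding_of_Br (mem_blowUp hE w) ((Br_blowUp_iff hE w hw m).2 (Br_of_braiding hW))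
end

section
/- If D_p is a p-diagram all of whose p chords are pairwise parallel (no two of its chords cross), then b(D_p) = p + 1. -/
/-- Weak descents. -/
def wdesc (f : ℕ → ℕ) : List ℕ → ℕ
  | [] => 0
  | [_] => 0
  | a :: b :: t => (if f b ≤ f a then 1 else 0) + wdesc f (b :: t)

def Good (S : List ℕ) : Prop :=
  (∀ x ∈ S, S.count x = 2) ∧ ∀ r s, r ≠ s → ¬ [r, s, r, s].Sublist S

theorem wdesc_insert (f : ℕ → ℕ) (x : ℕ) (l1 l2 : List ℕ) :
    wdesc f (l1 ++ l2) + 1 ≤ wdesc f (l1 ++ x :: x :: l2) := by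
  induction l1 with
  | nil =>
    cases l2 with
    | nil => simp [wdesc]
    | cons b t => simp [wdesc]; omega
  | cons a t ih =>
    cases t with
    | nil =>
      cases l2 with
      | nil => simp [wdesc]
      | cons b t => simp only [List.cons_append, List.nil_append, wdesc]; split_ifs <;> omega
    | cons c t => simp only [List.cons_append, wdesc] at *; omega

theorem wdesc_append (f : ℕ → ℕ) (A B : List ℕ) :
    wdesc f (A ++ B) ≤ wdesc f A + 1 + wdesc f B := by
  induction A with
  | nil => simp
  | cons a t ih =>
    cases t with
    | nil =>
      cases B with
      | nil => simp [wdesc]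
      | cons b t => simp only [List.cons_append, List.nil_append, wdesc]; split_ifs <;> omega
    | cons c t => simp only [List.cons_append, wdesc] at *; omega

theorem wdesc_sorted (f : ℕ → ℕ) (A : List ℕ) (h : A.Pairwise (fun a b => f a < f b)) :
    wdesc f A = 0 := by
  induction A with
  | nil => rfl
  | cons a t ih =>
    cases t with
    | nil => rfl
    | cons c t =>
      have h1 := ih (List.pairwise_cons.1 h).2
      have h2 := (List.pairwise_cons.1 h).1 c (by simp)
      simp only [wdesc, h1]
      rw [if_neg (by omega)]

theorem Good.adj : ∀ (n : ℕ) (S : List ℕ), S.length ≤ n → S ≠ [] → Good S →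
    ∃ l1 x l2, S = l1 ++ x :: x :: l2 := by
  intro n
  induction n with
  | zero => intro S h h0; simp at h; exact absurd h h0
  | succ n ih =>
    intro S hl h0 hS
    obtain ⟨x, T, rfl⟩ := List.exists_cons_of_ne_nil h0
    have hc := hS.1 x (by simp)
    have hxT : x ∈ T := by
      rw [← List.count_pos_iff]; rw [List.count_cons_self] at hc; omega
    obtain ⟨A, B, rfl⟩ := List.append_of_mem hxT
    by_cases hA : A = []
    · subst hA; exact ⟨[], x, B, rfl⟩
    have hxA : A.count x = 0 := by simp at hc; omega
    have hAg : Good A := by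
      constructor
      · intro y hy
        have hyx : y ≠ x := by
          rintro rfl; exact absurd hy (List.count_eq_zero.1 hxA)
        have h1 := hS.1 y (by simp [hy])
        have hB : y ∉ B := by
          intro hyB
          apply hS.2 x y hyx.symm
          refine List.Sublist.cons_cons x ?_
          have := (List.singleton_sublist.2 hy).append
            (List.Sublist.cons_cons x (List.singleton_sublist.2 hyB))
          simpa using this
        have := List.count_eq_zero.2 hB
        simp [hyx.symm, this] at h1
        exact h1
      · intro r s hrs h
        exact hS.2 r s hrs (h.trans ((List.sublist_append_left _ _).trans (List.sublist_cons_self _ _)))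
    obtain ⟨l1, y, l2, rfl⟩ := ih A (by simp at hl; omega) hA hAg
    exact ⟨x :: l1, y, l2 ++ x :: B, by simp⟩

theorem Good.induct {P : List ℕ → Prop} (h0 : P [])
    (h1 : ∀ l1 x l2, x ∉ l1 ++ l2 → P (l1 ++ l2) → P (l1 ++ x :: x :: l2)) :
    ∀ (n : ℕ) (S : List ℕ), S.length ≤ n → Good S → P S := by
  intro n
  induction n with
  | zero => intro S h _; simp at h; subst h; exact h0
  | succ n ih =>
    intro S hl hS
    by_cases hne : S = []
    · subst hne; exact h0
    obtain ⟨l1, x, l2, rfl⟩ := Good.adj _ S le_rfl hne hS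
    have hx : (l1 ++ l2).count x = 0 := by
      have := hS.1 x (by simp)
      simp at this; simp; omega
    have hx' := List.count_eq_zero.1 hx
    refine h1 l1 x l2 hx' (ih _ (by simp at hl ⊢; omega) ⟨?_, ?_⟩)
    · intro y hy
      have hyx : x ≠ y := by rintro rfl; exact hx' hy
      have := hS.1 y (by simp at hy ⊢; tauto)
      simpa [List.count_cons, hyx] using this
    · intro r s hrs h
      refine hS.2 r s hrs (h.trans ?_)
      exact (List.Sublist.refl l1).append ((List.sublist_cons_self _ _).trans (List.sublist_cons_self _ _))

theorem Good.le_wdesc (f : ℕ → ℕ) (S : List ℕ) (h : Good S) : S.length ≤ 2 * wdesc f S := by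
  refine Good.induct (P := fun S => S.length ≤ 2 * wdesc f S) (by simp) ?_ _ S le_rfl h
  intro l1 x l2 _ ih
  have := wdesc_insert f x l1 l2
  simp at ih ⊢; omega

theorem wdesc_congr (f g : ℕ → ℕ) (l : List ℕ)
    (h : ∀ a ∈ l, ∀ b ∈ l, (f b ≤ f a ↔ g b ≤ g a)) : wdesc f l = wdesc g l := by
  induction l with
  | nil => rfl
  | cons a t ih =>
    cases t with
    | nil => rfl
    | cons c t =>
      simp only [wdesc]
      rw [ih (fun a ha b hb => h a (by simp [ha]) b (by simp [hb]))]
      simp only [h a (by simp) c (by simp)]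

theorem wdesc_insert_after (g : ℕ → ℕ) (x : ℕ) (l1 l2 : List ℕ)
    (h : ∀ a ∈ l1.getLast?, g a < g x ∧ ∀ b ∈ l2, (g b ≤ g x ↔ g b ≤ g a))
    (h' : l1 = [] → ∀ b ∈ l2, g x < g b) :
    wdesc g (l1 ++ x :: x :: l2) ≤ wdesc g (l1 ++ l2) + 1 := by
  induction l1 with
  | nil =>
    cases l2 with
    | nil => simp [wdesc]
    | cons b t =>
      have := h' rfl b (by simp)
      simp [wdesc]; split_ifs <;> omega
  | cons a t ih =>
    cases t with
    | nil =>
      have ha := h a (by simp)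
      cases l2 with
      | nil => simp [wdesc]; omega
      | cons b t => 
        have hb := ha.2 b (by simp)
        simp only [List.cons_append, List.nil_append, wdesc]; split_ifs <;> omega
    | cons c t =>
      have := ih (by simpa using h) (by simp)
      simp only [List.cons_append, wdesc] at *; omega

theorem Good.exists_order (S : List ℕ) (h : Good S) :
    ∃ f : ℕ → ℕ, Set.InjOn f {x | x ∈ S} ∧ 2 * wdesc f S ≤ S.length := by
  refine Good.induct (P := fun S => ∃ f : ℕ → ℕ, Set.InjOn f {x | x ∈ S} ∧ 2 * wdesc f S ≤ S.length)
    ⟨id, by simp, by simp [wdesc]⟩ ?_ _ S le_rfl h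
  rintro l1 x l2 hx ⟨f, hf, hd⟩
  obtain ⟨v, hv, hv2⟩ : ∃ v, (∀ a ∈ l1.getLast?, v = 2 * f a + 2) ∧ (v % 2 = 0) ∧ (l1 = [] → v = 0) := by
    cases hl : l1.getLast? with
    | none => exact ⟨0, by simp, by simp⟩
    | some a => exact ⟨2 * f a + 2, by simp, by omega, by rintro rfl; simp at hl⟩
  let g : ℕ → ℕ := fun y => if y = x then v else 2 * f y + 1
  have gx : g x = v := by simp [g]
  have gy : ∀ y ∈ l1 ++ l2, g y = 2 * f y + 1 := by
    intro y hy
    have : y ≠ x := by rintro rfl; exact hx hy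
    simp [g, this]
  refine ⟨g, ?_, ?_⟩
  · have key : ∀ y, y ∈ l1 ++ x :: x :: l2 → y = x ∨ y ∈ l1 ++ l2 := by
      intro y hy; simp at hy ⊢; tauto
    intro y hy z hz hyz
    rcases key y hy with hy' | hy'
    · rcases key z hz with hz' | hz'
      · rw [hy', hz']
      · rw [hy', gx, gy z hz'] at hyz; omega
    · rcases key z hz with hz' | hz'
      · rw [hz', gx, gy y hy'] at hyz; omega
      · rw [gy y hy', gy z hz'] at hyz; exact hf hy' hz' (by omega)
  · have h1 := wdesc_insert_after g x l1 l2 (by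
      intro a ha
      have ha1 : a ∈ l1 := List.mem_of_getLast? ha
      rw [gx, hv a ha, gy a (by simp [ha1])]
      refine ⟨by omega, fun b hb => ?_⟩
      rw [gy b (by simp [hb])]; omega) (by
      intro h0 b hb
      rw [gx, hv2.2 h0, gy b (by simp [hb])]; omega)
    have h2 : wdesc g (l1 ++ l2) = wdesc f (l1 ++ l2) :=
      wdesc_congr _ _ _ (fun a ha b hb => by rw [gy a ha, gy b hb]; omega)
    simp at hd ⊢; omega

theorem exists_runs (f : ℕ → ℕ) (l : List ℕ) : ∀ d, wdesc f l ≤ d →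
    ∃ R : ℕ → List ℕ, (List.range (d + 1)).flatMap R = l ∧
      (∀ s, (R s).Pairwise (fun a b => f a < f b)) ∧ (∀ a ∈ l.head?, a ∈ (R 0).head?) := by
  induction l with
  | nil => intro d _; exact ⟨fun _ => [], by simp, by simp, by simp⟩
  | cons a t ih =>
    intro d hd
    cases t with
    | nil =>
      refine ⟨fun s => if s = 0 then [a] else [], ?_, ?_, by simp⟩
      · rw [List.range_succ_eq_map]; simp [List.flatMap_map]
      · intro s; dsimp only; split_ifs <;> simp
    | cons c t =>
      by_cases hca : f c ≤ f a
      · simp only [wdesc, if_pos hca] at hd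
        obtain ⟨e, rfl⟩ : ∃ e, d = e + 1 := ⟨d - 1, by omega⟩
        obtain ⟨R, hR, hs, -⟩ := ih e (by omega)
        refine ⟨fun s => if s = 0 then [a] else R (s - 1), ?_, ?_, by simp⟩
        · rw [List.range_succ_eq_map]; simp [List.flatMap_map, hR]
        · intro s; dsimp only; split_ifs
          · simp
          · exact hs _
      · simp only [wdesc, if_neg hca] at hd
        obtain ⟨R, hR, hs, hh⟩ := ih d (by omega)
        have hc : c ∈ (R 0).head? := hh c (by simp)
        obtain ⟨u, hu⟩ : ∃ u, R 0 = c :: u := by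
          cases h : R 0 with
          | nil => simp [h] at hc
          | cons z u => simp [h] at hc; subst hc; exact ⟨u, rfl⟩
        refine ⟨fun s => if s = 0 then a :: R 0 else R s, ?_, ?_, by simp⟩
        · rw [List.range_succ_eq_map] at hR ⊢
          simp [List.flatMap_map] at hR ⊢
          exact hR
        · intro s; dsimp only; split_ifs
          · have h0 := hs 0
            rw [List.pairwise_cons]
            refine ⟨?_, h0⟩
            rw [hu] at h0 ⊢
            intro b hb
            rcases List.mem_cons.1 hb with rfl | hb
            · omega
            · have := (List.pairwise_cons.1 h0).1 b hb; omega
          · exact hs _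

theorem IsName.mem {p : ℕ} {N : List ℕ} (hN : IsName p N) (y : ℕ) :
    y ∈ N ↔ 1 ≤ y ∧ y ≤ p := by
  have hsub : Finset.Icc 1 p ⊆ N.toFinset := by
    intro x hx
    rw [Finset.mem_Icc] at hx
    have := hN.2 x hx.1 hx.2
    rw [List.mem_toFinset, ← List.count_pos_iff]; omega
  constructor
  · intro hy
    by_contra hcon
    have h1 : ∑ a ∈ N.toFinset, N.count a = N.length := List.sum_toFinset_count_eq_length N
    have h2 : ∑ a ∈ Finset.Icc 1 p, N.count a = 2 * p := by
      rw [Finset.sum_congr rfl (g := fun _ => 2)]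
      · simp; ring
      · intro x hx; rw [Finset.mem_Icc] at hx; exact hN.2 x hx.1 hx.2
    have h3 : ∑ a ∈ Finset.Icc 1 p, N.count a < ∑ a ∈ N.toFinset, N.count a :=
      Finset.sum_lt_sum_of_subset hsub (i := y) (by simpa using hy)
        (by simpa using hcon) (List.count_pos_iff.2 hy) (by simp)
    have := hN.1
    omega
  · intro hy
    have := hsub (Finset.mem_Icc.2 hy)
    simpa using this

theorem standardName_wdesc (W : List (ℕ × ℕ)) (m : ℕ) :
    wdesc id (standardName (m + 1) W) ≤ m := by
  have hs : ∀ s : ℕ, wdesc id (((List.range W.length).filter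
      (fun r => decide ((W.getD r (0, 0)).1 = s + 1 ∨ (W.getD r (0, 0)).2 = s + 1))).map
      (· + 1)) = 0 := by
    intro s
    apply wdesc_sorted
    rw [List.pairwise_map]
    refine List.Pairwise.filter _ ?_
    exact List.pairwise_lt_range.imp (by simp)
  induction m with
  | zero =>
    unfold standardName
    simpa using (hs 0).le
  | succ m ih =>
    unfold standardName at *
    rw [List.range_succ, List.flatMap_append]
    refine (wdesc_append _ _ _).trans ?_
    have := hs (m + 1)
    rw [List.flatMap_singleton, this]
    omega

theorem lower_bound {p m : ℕ} {N : List ℕ} (hN : IsName p N)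
    (hpar : ∀ r s, 1 ≤ r → r ≤ p → 1 ≤ s → s ≤ p → r ≠ s → ¬Crosses N r s)
    (hm : 1 ≤ m) (W : List (ℕ × ℕ)) (hW : IsBraiding p m W N) : p + 1 ≤ m := by
  obtain ⟨-, k, σ, -, hk⟩ := hW
  obtain ⟨m, rfl⟩ : ∃ e, m = e + 1 := ⟨m - 1, by omega⟩
  have hd := standardName_wdesc W m
  generalize standardName (m + 1) W = S at *
  have hlen : S.length = 2 * p := by
    have := congrArg List.length hk; simp at this; rw [← this, hN.1]
  have hmemN : ∀ x, x ∈ S → σ x ∈ N := by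
    intro x hx; rw [hk]; simp [hx]
  have hg : Good S := by
    constructor
    · intro x hx
      have h1 := (hN.mem _).1 (hmemN x hx)
      have h2 := hN.2 _ h1.1 h1.2
      rw [hk, List.count_map_of_injective _ _ σ.injective,
        (List.rotate_perm S k).count_eq] at h2
      exact h2
    · intro r s hrs h
      have hr := (hN.mem _).1 (hmemN r (h.subset (by simp)))
      have hs := (hN.mem _).1 (hmemN s (h.subset (by simp)))
      refine hpar _ _ hr.1 hr.2 hs.1 hs.2 (fun e => hrs (σ.injective e)) ?_
      have : S.rotate k ~r S := List.IsRotated.symm ⟨k, rfl⟩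
      obtain ⟨j, hj⟩ := this
      refine ⟨j, ?_⟩
      rw [hk, ← List.map_rotate, hj]
      simpa using h.map σ
  have := hg.le_wdesc id
  omega

theorem exists_perm_of_list (p : ℕ) (L : List ℕ) (hL : L.length = p) (hnd : L.Nodup)
    (hmem : ∀ x, x ∈ L ↔ 1 ≤ x ∧ x ≤ p) :
    ∃ σ : Equiv.Perm ℕ, (∀ x, 1 ≤ x → x ≤ p → 1 ≤ σ x ∧ σ x ≤ p) ∧
      ∀ r, r < p → σ (r + 1) = L.getD r 0 := by
  let g : ℕ → ℕ := fun x => if 1 ≤ x ∧ x ≤ p then L.getD (x - 1) 0 else x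
  have hgetm : ∀ r, r < p → L.getD r 0 ∈ L := by
    intro r hr
    rw [List.getD_eq_getElem _ _ (by omega)]; exact List.getElem_mem _
  have h1 : ∀ x, 1 ≤ x → x ≤ p → 1 ≤ g x ∧ g x ≤ p := by
    intro x hx hx'
    simp only [g, if_pos (And.intro hx hx')]
    exact (hmem _).1 (hgetm _ (by omega))
  have h2 : ∀ x, ¬ (1 ≤ x ∧ x ≤ p) → g x = x := by
    intro x hx; simp only [g, if_neg hx]
  have hinj : Function.Injective g := by
    intro x y hxy
    by_cases hx : 1 ≤ x ∧ x ≤ p <;> by_cases hy : 1 ≤ y ∧ y ≤ p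
    · simp only [g, if_pos hx, if_pos hy] at hxy
      rw [List.getD_eq_getElem _ _ (by omega), List.getD_eq_getElem _ _ (by omega),
        hnd.getElem_inj_iff] at hxy
      omega
    · rw [h2 y hy] at hxy; have := h1 x hx.1 hx.2; rw [hxy] at this; exact absurd this hy
    · rw [h2 x hx] at hxy; have := h1 y hy.1 hy.2; rw [← hxy] at this; exact absurd this hx
    · rwa [h2 x hx, h2 y hy] at hxy
  have hsurj : Function.Surjective g := by
    intro y
    by_cases hy : 1 ≤ y ∧ y ≤ p
    · obtain ⟨i, hi, rfl⟩ := List.getElem_of_mem ((hmem y).2 hy)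
      refine ⟨i + 1, ?_⟩
      simp only [g]
      rw [if_pos (by omega), Nat.add_sub_cancel, List.getD_eq_getElem _ _ hi]
    · exact ⟨y, h2 y hy⟩
  refine ⟨Equiv.ofBijective g ⟨hinj, hsurj⟩, fun x hx hx' => h1 x hx hx', ?_⟩
  intro r hr
  change g (r + 1) = _
  simp only [g]
  rw [if_pos (by omega), Nat.add_sub_cancel]

theorem exists_two (n x : ℕ) (R : ℕ → List ℕ) (hnd : ∀ s, (R s).Nodup)
    (hc : ((List.range n).flatMap R).count x = 2) :
    ∃ i j, i < j ∧ j < n ∧ ∀ s < n, (x ∈ R s ↔ (i = s ∨ j = s)) := by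
  have h1 : ((Finset.range n).filter (fun s => x ∈ R s)).card = 2 := by
    rw [← hc]
    clear hc
    induction n with
    | zero => simp
    | succ n ih =>
      rw [List.range_succ, List.flatMap_append, List.flatMap_singleton, List.count_append,
        Finset.range_add_one, Finset.filter_insert, ← ih]
      by_cases hx : x ∈ R n
      · rw [if_pos hx, Finset.card_insert_of_notMem (by simp),
          List.count_eq_one_of_mem (hnd n) hx]
      · rw [if_neg hx, List.count_eq_zero.2 hx, Nat.add_zero]
  obtain ⟨i, j, hij, hs⟩ := Finset.card_eq_two.1 h1
  have hm : ∀ s, (s < n ∧ x ∈ R s) ↔ (s = i ∨ s = j) := by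
    intro s
    have := Finset.ext_iff.1 hs s
    simpa using this
  rcases lt_or_gt_of_ne hij with h | h
  · refine ⟨i, j, h, ((hm j).2 (by simp)).1, fun s hsn => ?_⟩
    have := hm s; grind
  · refine ⟨j, i, h, ((hm i).2 (by simp)).1, fun s hsn => ?_⟩
    have := hm s; grind

theorem upper_bound {p : ℕ} {N : List ℕ} (hN : IsName p N)
    (hpar : ∀ r s, 1 ≤ r → r ≤ p → 1 ≤ s → s ≤ p → r ≠ s → ¬Crosses N r s) :
    ∃ W, IsBraiding p (p + 1) W N := by
  have hg : Good N := by
    constructor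
    · intro x hx
      have := (hN.mem x).1 hx
      exact hN.2 x this.1 this.2
    · intro r s hrs h
      have hr := (hN.mem _).1 (h.subset (show r ∈ _ by simp))
      have hs := (hN.mem _).1 (h.subset (show s ∈ _ by simp))
      exact hpar r s hr.1 hr.2 hs.1 hs.2 hrs ⟨0, by simpa using h⟩
  obtain ⟨f, hf, hd⟩ := hg.exists_order
  obtain ⟨R, hR, hRs, -⟩ := exists_runs f N p (by rw [hN.1] at hd; omega)
  have hRmem : ∀ s < p + 1, ∀ x ∈ R s, 1 ≤ x ∧ x ≤ p := by
    intro s hs x hx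
    rw [← hN.mem, ← hR, List.mem_flatMap]
    exact ⟨s, by simpa using hs, hx⟩
  have hRnd : ∀ s, (R s).Nodup := fun s => (hRs s).imp (by rintro a b h rfl; omega)
  let L := (List.range' 1 p).insertionSort (fun a b => f a ≤ f b)
  have hperm : L.Perm (List.range' 1 p) := List.perm_insertionSort _ _
  have hLlen : L.length = p := by rw [hperm.length_eq]; simp
  have hLnd : L.Nodup := hperm.nodup_iff.2 List.nodup_range'
  have hLmem : ∀ x, x ∈ L ↔ 1 ≤ x ∧ x ≤ p := by
    intro x; rw [hperm.mem_iff, List.mem_range'_1]; omega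
  have hLs : L.Pairwise (fun a b => f a ≤ f b) := by
    have : Std.Total (fun a b : ℕ => f a ≤ f b) := ⟨fun a b => le_total _ _⟩
    have : IsTrans ℕ (fun a b : ℕ => f a ≤ f b) := ⟨fun a b c => le_trans⟩
    exact List.pairwise_insertionSort _ _
  obtain ⟨σ, hσ, hσL⟩ := exists_perm_of_list p L hLlen hLnd hLmem
  have h2 : ∀ x, ∃ i j, (1 ≤ x ∧ x ≤ p) →
      (i < j ∧ j < p + 1 ∧ ∀ s < p + 1, (x ∈ R s ↔ (i = s ∨ j = s))) := by
    intro x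
    by_cases hx : 1 ≤ x ∧ x ≤ p
    · obtain ⟨i, j, h⟩ := exists_two (p + 1) x R hRnd (by rw [hR]; exact hN.2 x hx.1 hx.2)
      exact ⟨i, j, fun _ => h⟩
    · exact ⟨0, 0, fun h => absurd h hx⟩
  choose I J hIJ using h2
  refine ⟨L.map (fun x => (I x + 1, J x + 1)), ?_, 0, σ, hσ, ?_⟩
  · intro q hq
    obtain ⟨x, hx, rfl⟩ := List.mem_map.1 hq
    have := hIJ x ((hLmem x).1 hx)
    dsimp only
    omega
  · rw [List.rotate_zero]
    unfold standardName
    rw [List.map_flatMap, ← hR]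
    rw [List.flatMap_def, List.flatMap_def]
    congr 1
    apply List.map_congr_left
    intro s hs
    rw [List.mem_range] at hs
    rw [List.length_map, hLlen]
    have e1 : ((List.range p).filter (fun r => decide
        (((L.map (fun x => (I x + 1, J x + 1))).getD r (0, 0)).1 = s + 1 ∨
        ((L.map (fun x => (I x + 1, J x + 1))).getD r (0, 0)).2 = s + 1))) =
        (List.range p).filter ((fun x => decide (x ∈ R s)) ∘ (fun r => L.getD r 0)) := by
      apply List.filter_congr
      intro r hr
      rw [List.mem_range] at hr
      have hrL : r < L.length := by omega
      have := (hIJ L[r] ((hLmem _).1 (List.getElem_mem hrL))).2.2 s hs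
      rw [List.getD_eq_getElem _ _ (by simpa using hrL)]
      simp [hrL, this]
    rw [e1, List.map_map]
    have e2 : ∀ l : List ℕ, (∀ r ∈ l, r < p) →
        l.map (⇑σ ∘ fun x => x + 1) = l.map (fun r => L.getD r 0) := by
      intro l hl
      apply List.map_congr_left
      intro r hr
      exact hσL r (hl r hr)
    rw [e2 _ (by intro r hr; exact List.mem_range.1 (List.mem_filter.1 hr).1),
      ← List.filter_map]
    have e3 : (List.range p).map (fun r => L.getD r 0) = L := by
      apply List.ext_getElem
      · simp [hLlen]
      · intro i h1 h2; simp [h2]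
    rw [e3]
    have hp : (R s).Perm (L.filter (fun x => decide (x ∈ R s))) := by
      rw [List.perm_ext_iff_of_nodup (hRnd s) (hLnd.filter _)]
      intro a
      simp only [List.mem_filter, hLmem, decide_eq_true_eq]
      exact ⟨fun h => ⟨hRmem s hs a h, h⟩, fun h => h.2⟩
    refine List.Perm.eq_of_pairwise (le := fun a b => f a ≤ f b) ?_ ((hRs s).imp le_of_lt)
      (hLs.filter _) hp
    intro a b ha hb hab hba
    refine hf ?_ ?_ (le_antisymm hab hba)
    · exact (hN.mem a).2 (hRmem s hs a ha)
    · exact (hN.mem b).2 ((hLmem b).1 (List.mem_filter.1 hb).1)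

/-- If `D_p` is a `p`-diagram all of whose chords are pairwise
parallel, then `b(D_p) = p + 1`. -/
theorem braidIndex_parallel_diagram (p : ℕ) (N : List ℕ) (hN : IsName p N)
    (hpar : ∀ r s, 1 ≤ r → r ≤ p → 1 ≤ s → s ≤ p → r ≠ s → ¬Crosses N r s) :
    braidIndex p N = p + 1 := by
  apply le_antisymm
  · exact Nat.sInf_le ⟨by omega, upper_bound hN hpar⟩
  · have hne : {m | 1 ≤ m ∧ ∃ W, IsBraiding p m W N}.Nonempty :=
      ⟨p + 1, by omega, upper_bound hN hpar⟩
    obtain ⟨h1, W, hW⟩ := Nat.sInf_mem hne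
    exact lower_bound hN hpar h1 W hW
end

section
/- Let V and W be chord words on 3 strands that are braidings of the same diagram D. Then either V and W are cyclically equivalent, or there exist integers l, m, n ≥ 1 such that one of the two words is cyclically equivalent to a^l c^m a^n and the other is cyclically equivalent to a^l c^n a^m. -/
/-- Time data of a braiding on the universal cover. -/
structure Bd (n : ℤ) (π T : ℤ → ℤ) : Prop where
  pos : 0 < n
  mono : StrictMono T
  per : ∀ i, T (i + 2 * n) = T i + 3 * n
  e : ∀ i, T (π i) = T i + n ∨ T (π i) = T i + 2 * n
  pp : ∀ i, π (π i) = i + 2 * n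
  exc : ∀ i j, T j = T i + n ∨ T j = T i + 2 * n → j = π i
  sur : ∀ t, ((∃ i, T i = t) ∧ (∃ i, T i = t + n)) ∨ ((∃ i, T i = t) ∧ (∃ i, T i = t + 2 * n)) ∨
    ((∃ i, T i = t + n) ∧ (∃ i, T i = t + 2 * n))

namespace Bd

variable {n : ℤ} {π T T' : ℤ → ℤ}

theorem lt_iff (h : Bd n π T) {i j : ℤ} : T i < T j ↔ i < j := h.mono.lt_iff_lt

theorem lt1 (h : Bd n π T) (i : ℤ) : i < π i := by
  rw [← h.lt_iff]; have := h.pos; rcases h.e i with h1 | h1 <;> omega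

theorem lt2 (h : Bd n π T) (i : ℤ) : π i < i + 2 * n := by
  rw [← h.lt_iff, h.per]; have := h.pos; rcases h.e i with h1 | h1 <;> omega

theorem inj (h : Bd n π T) {i j : ℤ} (hij : π i = π j) : i = j := by
  have h1 := h.pp i
  have h2 := h.pp j
  rw [hij] at h1; omega

theorem pper (h : Bd n π T) (i : ℤ) : π (i + 2 * n) = π i + 2 * n := by
  rw [← h.pp i, h.pp (π i)]

theorem perN (h : Bd n π T) (i : ℤ) (N : ℕ) : T (i + 2 * n * N) = T i + 3 * n * N := by
  induction N with
  | zero => simp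
  | succ N ih =>
    have := h.per (i + 2 * n * N)
    push_cast
    rw [show i + 2 * n * ((N : ℤ) + 1) = i + 2 * n * N + 2 * n by ring, this, ih]; ring

theorem perZ (h : Bd n π T) (i q : ℤ) : T (i + 2 * n * q) = T i + 3 * n * q := by
  obtain ⟨N, rfl | rfl⟩ := q.eq_nat_or_neg
  · exact h.perN i N
  · have := h.perN (i + 2 * n * (-N)) N
    rw [show i + 2 * n * (-(N:ℤ)) + 2 * n * N = i by ring] at this
    linarith

/-- sign at the partner is opposite -/
theorem e_pi (h : Bd n π T) (i : ℤ) : T (π (π i)) - T (π i) = 3 * n - (T (π i) - T i) := by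
  rw [h.pp, h.per]; ring

theorem same_aux (h : Bd n π T) (h' : Bd n π T')
    (hs : ∀ i, T (π i) - T i = T' (π i) - T' i) (i j k : ℤ) (hk : T i = T j + k * n) :
    T' i = T' j + k * n := by
  have hdm := Int.emod_add_mul_ediv k 3
  have hr0 := Int.emod_nonneg k (show (3:ℤ) ≠ 0 by norm_num)
  have hr3 := Int.emod_lt_of_pos k (show (0:ℤ) < 3 by norm_num)
  generalize k % 3 = r at *
  generalize k / 3 = q at *
  subst hdm
  have hT := h.perZ j q
  have hT' := h'.perZ j q
  generalize j + 2 * n * q = j' at *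
  have hk2 : T i = T j' + r * n := by rw [hT, hk]; ring
  have goal2 : T' i = T' j' + r * n := by
    have := hs j'
    interval_cases r
    · have : i = j' := h.mono.injective (by linarith)
      subst this; ring
    · have hi : i = π j' := h.exc _ _ (by left; linarith)
      subst hi; linarith
    · have hi : i = π j' := h.exc _ _ (by right; linarith)
      subst hi; linarith
  rw [goal2, hT']; ring

theorem const_of_periodic (g : ℤ → ℤ) (m : ℤ) (hm : 0 < m) (hg : ∀ t, g t ≤ g (t + 1))
    (hp : ∀ t, g (t + m) = g t) (t u : ℤ) : g t = g u := by
  have mono : Monotone g := monotone_int_of_le_succ hg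
  have hpN : ∀ (N : ℕ) t, g (t + m * N) = g t := by
    intro N
    induction N with
    | zero => simp
    | succ N ih =>
      intro t
      push_cast
      rw [show t + m * ((N:ℤ) + 1) = t + m * N + m by ring, hp, ih]
  have key : ∀ t u, t ≤ u → g t = g u := by
    intro t u htu
    apply le_antisymm (mono htu)
    rw [← hpN (u - t).toNat t]
    apply mono
    have : ((u - t).toNat : ℤ) = u - t := by omega
    rw [this]
    nlinarith
  rcases le_total t u with h | h
  · exact key t u h
  · exact (key u t h).symm

theorem same (h : Bd n π T) (h' : Bd n π T')
    (hs : ∀ i, T (π i) - T i = T' (π i) - T' i) : ∃ s, ∀ i, T' i = T i + s := by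
  have H := same_aux h h' hs
  have hex : ∀ t, ∃ i k, T i = t + k * n := by
    intro t
    rcases h.sur t with ⟨⟨i, hi⟩, _⟩ | ⟨⟨i, hi⟩, _⟩ | ⟨⟨i, hi⟩, _⟩
    · exact ⟨i, 0, by linarith⟩
    · exact ⟨i, 0, by linarith⟩
    · exact ⟨i, 1, by linarith⟩
  choose a c hac using hex
  let Φ : ℤ → ℤ := fun t => T' (a t) - c t * n
  have hΦ : ∀ t i k, T i = t + k * n → Φ t = T' i - k * n := by
    intro t i k hi
    have := H i (a t) (k - c t) (by rw [hi, hac]; ring)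
    simp only [Φ]
    rw [this]; ring
  have hmono : ∀ t u, t < u → Φ t < Φ u := by
    intro t u htu
    have key : ∀ k i j, T i = t + k * n → T j = u + k * n → Φ t < Φ u := by
      intro k i j hi hj
      rw [hΦ t i k hi, hΦ u j k hj]
      have : i < j := by rw [← h.lt_iff, hi, hj]; linarith
      have := h'.mono this
      linarith
    rcases h.sur t with ⟨⟨i, hi⟩, ⟨i', hi'⟩⟩ | ⟨⟨i, hi⟩, ⟨i', hi'⟩⟩ | ⟨⟨i, hi⟩, ⟨i', hi'⟩⟩ <;>
    rcases h.sur u with ⟨⟨j, hj⟩, ⟨j', hj'⟩⟩ | ⟨⟨j, hj⟩, ⟨j', hj'⟩⟩ | ⟨⟨j, hj⟩, ⟨j', hj'⟩⟩ <;>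
    first
    | exact key 0 i j (by linarith) (by linarith)
    | exact key 1 i j (by linarith) (by linarith)
    | exact key 1 i' j (by linarith) (by linarith)
    | exact key 1 i j' (by linarith) (by linarith)
    | exact key 1 i' j' (by linarith) (by linarith)
    | exact key 2 i' j' (by linarith) (by linarith)
  have hper : ∀ t, Φ (t + 3 * n) = Φ t + 3 * n := by
    intro t
    have := hΦ (t + 3 * n) (a t) (c t - 3) (by rw [hac]; ring)
    rw [this]; simp only [Φ]; ring
  refine ⟨Φ 0, fun i => ?_⟩
  have h1 := hΦ (T i) i 0 (by ring)
  have h2 := const_of_periodic (fun t => Φ t - t) (3 * n) (by have := h.pos; linarith)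
    (fun t => by have := hmono t (t + 1) (by linarith); omega)
    (fun t => by simp only [hper]; ring) (T i) 0
  linarith

/-- a chord with differing orientations crosses everything (one side) -/
theorem cross1 (h : Bd n π T) {f i : ℤ} (hf : T (π f) = T f + n) (h1 : f < i) (h2 : i < π f) :
    π f < π i ∧ π i < f + 2 * n := by
  have aux : ∀ j, f < j → j < π f → π f < π j := by
    intro j h1 h2
    by_contra hc
    have hne : π j ≠ π f := fun hh => by have := h.inj hh; omega
    have h3 : π j < π f := by omega
    have a1 := h.mono h1
    have a2 := h.mono h3
    have := h.pos
    rcases h.e j with h4 | h4 <;> omega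
  refine ⟨aux i h1 h2, ?_⟩
  by_contra hc
  have hne : π i ≠ f + 2 * n := fun hh => by
    rw [← h.pp f] at hh
    have := h.inj hh; omega
  have e1 := h.pper (π i - 2 * n)
  rw [sub_add_cancel, h.pp] at e1
  have := aux (π i - 2 * n) (by omega) (by have := h.lt2 i; omega)
  omega

theorem diam_le (h : Bd n π T) {f : ℤ} (hf : T (π f) = T f + n) : π f - f ≤ n := by
  have h1 : (Finset.Ioo f (π f)).card ≤ (Finset.Ioo (π f) (f + 2 * n)).card := by
    apply Finset.card_le_card_of_injOn π
    · intro i hi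
      simp only [Finset.coe_Ioo, Set.mem_Ioo] at hi ⊢
      exact h.cross1 hf hi.1 hi.2
    · intro i _ j _ hij
      exact h.inj hij
  simp only [Int.card_Ioo] at h1
  have := h.lt1 f
  have := h.lt2 f
  omega

theorem diam (h : Bd n π T) (h' : Bd n π T') {f : ℤ} (hf : T (π f) = T f + n)
    (hf' : T' (π f) = T' f + 2 * n) : π f = f + n := by
  have h1 := h.diam_le hf
  have h2 := h'.diam_le (f := π f) (by rw [h'.pp, h'.per, hf']; ring)
  rw [h.pp] at h2
  omega

theorem triple (h : Bd n π T) {i j k : ℤ} (h1 : i < j) (h3 : k < π i)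
    (h4 : π j < π k) (hi : T (π i) = T i + n) (hj : T (π j) = T j + 2 * n) :
    T (π k) = T k + 2 * n := by
  have a1 := h.mono h1
  have a3 := h.mono h3
  have a4 := h.mono h4
  rcases h.e k with h5 | h5
  · omega
  · exact h5

theorem triple' (h : Bd n π T) {i j k : ℤ} (h1 : i < j) (h2 : j < k) (h3 : π i < π j)
    (h4 : π k < i + 2 * n) (hi : T (π i) = T i + 2 * n) (hj : T (π j) = T j + n) :
    T (π k) = T k + n := by
  rcases h.e k with h5 | h5
  · exact h5
  · exfalso
    have := h.triple (i := j) (j := k) (k := π i) h2 h3 (by rw [h.pp]; exact h4) hj h5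
    rw [h.pp, h.per, hi] at this
    have := h.pos
    omega

end Bd

namespace Bd

variable {n : ℤ} {π T T' : ℤ → ℤ}

theorem thr (p : ℕ → Prop) (n : ℕ) (hp : ∀ i j, i < j → j < n → p j → p i) :
    ∃ l ≤ n, ∀ i < n, p i ↔ i < l := by
  induction n with
  | zero => exact ⟨0, le_refl _, by simp⟩
  | succ n ih =>
    obtain ⟨l, hl, h⟩ := ih (fun i j h1 h2 => hp i j h1 (by omega))
    by_cases hn : p n
    · refine ⟨n + 1, le_refl _, fun i hi => ⟨fun _ => hi, fun _ => ?_⟩⟩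
      rcases Nat.lt_succ_iff_lt_or_eq.1 hi with h1 | h1
      · exact hp i n h1 (by omega) hn
      · rw [h1]; exact hn
    · refine ⟨l, by omega, fun i hi => ?_⟩
      rcases Nat.lt_succ_iff_lt_or_eq.1 hi with h1 | h1
      · exact h i h1
      · subst h1
        constructor
        · intro h2; exact absurd h2 hn
        · intro h2; omega

/-- local rule for two points in the half circle after `f0` -/
theorem rule (h : Bd n π T) (h' : Bd n π T') {f0 i j : ℤ} (hf : T (π f0) = T f0 + n)
    (hf' : T' (π f0) = T' f0 + 2 * n) (h0 : f0 < i) (hij : i < j) (hj : j < f0 + n) :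
    (¬ (T (π i) = T i + 2 * n ∧ T (π j) = T j + n) ∧
      ¬ (T' (π i) = T' i + n ∧ T' (π j) = T' j + 2 * n)) ∨
    (T (π i) = T i + 2 * n ∧ T' (π i) = T' i + 2 * n ∧ T (π j) = T j + n ∧
      T' (π j) = T' j + n) := by
  have hd := h.diam h' hf hf'
  have hn := h.pos
  have ci := h.cross1 hf h0 (by omega)
  have cj := h.cross1 hf (i := j) (by omega) (by omega)
  rcases lt_trichotomy (π i) (π j) with hc | hc | hc
  · left
    constructor
    · rintro ⟨a, b⟩
      have := h.triple (i := f0) (j := i) (k := j) h0 (by omega) hc hf a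
      omega
    · rintro ⟨a, b⟩
      have := h'.triple' (i := f0) (j := i) (k := j) h0 hij ci.1 cj.2 hf' a
      omega
  · have := h.inj hc; omega
  · right
    have key : ∀ T : ℤ → ℤ, Bd n π T → T (π i) = T i + 2 * n ∧ T (π j) = T j + n := by
      intro T h
      have a1 := h.mono hij
      have a2 := h.mono hc
      rcases h.e i with h1 | h1 <;> rcases h.e j with h2 | h2 <;> first | omega | exact ⟨h1, h2⟩
    obtain ⟨k1, k2⟩ := key T h
    obtain ⟨k3, k4⟩ := key T' h'
    exact ⟨k1, k3, k2, k4⟩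

/-- the pattern of orientations on the half circle starting at `f0` -/
def Pat (n : ℤ) (π T T' : ℤ → ℤ) (f0 : ℤ) (l m k : ℕ) : Prop :=
  (l : ℤ) + m + k = n ∧ ∀ i : ℤ, 0 ≤ i → i < n →
    ((T (π (f0 + i)) = T (f0 + i) + n ∧ T' (π (f0 + i)) = T' (f0 + i) + 2 * n ∧ i < l) ∨
    (T (π (f0 + i)) = T (f0 + i) + 2 * n ∧ T' (π (f0 + i)) = T' (f0 + i) + 2 * n ∧
      l ≤ i ∧ i < l + m) ∨
    (T (π (f0 + i)) = T (f0 + i) + n ∧ T' (π (f0 + i)) = T' (f0 + i) + n ∧ l + m ≤ i))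

theorem sign (h : Bd n π T) (h' : Bd n π T') {f0 : ℤ} (hf : T (π f0) = T f0 + n)
    (hf' : T' (π f0) = T' f0 + 2 * n)
    (hp : ¬ (T (π (f0 - 1)) = T (f0 - 1) + n ∧ T' (π (f0 - 1)) = T' (f0 - 1) + 2 * n)) :
    ∃ l m k : ℕ, 1 ≤ l ∧ Pat n π T T' f0 l m k := by
  have hn := h.pos
  obtain ⟨N, rfl⟩ : ∃ N : ℕ, n = N := ⟨n.toNat, by omega⟩
  -- the last point is not of the opposite kind
  have hlast : ¬ (T (π (f0 + N - 1)) = T (f0 + N - 1) + 2 * N ∧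
      T' (π (f0 + N - 1)) = T' (f0 + N - 1) + N) := by
    rintro ⟨a, b⟩
    have hd := h'.diam h b a
    have e1 := h.e_pi (f0 + N - 1)
    have e2 := h'.e_pi (f0 + N - 1)
    rw [hd, show f0 + N - 1 + (N : ℤ) = (f0 - 1) + 2 * N by ring] at e1 e2 a b
    rw [h.pper, h.per, h.per] at e1
    rw [h'.pper, h'.per, h'.per] at e2
    rw [h.per] at a
    rw [h'.per] at b
    exact hp ⟨by linarith, by linarith⟩
  have R := fun i j h0 hij hj => rule h h' (i := i) (j := j) hf hf' h0 hij hj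
  have noneg : ∀ i : ℤ, f0 ≤ i → i < f0 + N →
      ¬ (T (π i) = T i + 2 * N ∧ T' (π i) = T' i + N) := by
    rintro i h1 h2 ⟨a, b⟩
    rcases eq_or_lt_of_le h1 with h3 | h3
    · subst h3; omega
    · by_cases h4 : i = f0 + N - 1
      · subst h4; exact hlast ⟨a, b⟩
      · have r := R i (f0 + N - 1) h3 (by omega) (by omega)
        have := h.e (f0 + N - 1)
        have := h'.e (f0 + N - 1)
        omega
  have dF : ∀ i j : ℤ, f0 ≤ i → i < j → j < f0 + N →
      (T (π j) = T j + N ∧ T' (π j) = T' j + 2 * N) →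
      (T (π i) = T i + N ∧ T' (π i) = T' i + 2 * N) := by
    rintro i j h1 h2 h3 ⟨a, b⟩
    rcases eq_or_lt_of_le h1 with h4 | h4
    · subst h4; exact ⟨hf, hf'⟩
    · have r := R i j h4 h2 h3
      have := noneg i h1 (by omega)
      have := h.e i
      have := h'.e i
      omega
  have dG : ∀ i j : ℤ, f0 ≤ i → i < j → j < f0 + N →
      (T' (π j) = T' j + 2 * N) → (T' (π i) = T' i + 2 * N) := by
    rintro i j h1 h2 h3 b
    rcases eq_or_lt_of_le h1 with h4 | h4
    · subst h4; exact hf'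
    · have r := R i j h4 h2 h3
      have := noneg i h1 (by omega)
      have := h.e i
      have := h'.e i
      omega
  obtain ⟨l, hl, hl2⟩ := thr (fun i : ℕ => T (π (f0 + i)) = T (f0 + i) + N ∧
      T' (π (f0 + i)) = T' (f0 + i) + 2 * N) N
    (fun i j h1 h2 => dF _ _ (by omega) (by omega) (by omega))
  obtain ⟨q, hq, hq2⟩ := thr (fun i : ℕ => T' (π (f0 + i)) = T' (f0 + i) + 2 * N) N
    (fun i j h1 h2 => dG _ _ (by omega) (by omega) (by omega))
  have hl1 : 1 ≤ l := by
    have := (hl2 0 (by omega)).1 (by simpa using ⟨hf, hf'⟩)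
    omega
  have hlq : l ≤ q := by
    have := (hl2 (l - 1) (by omega)).2 (by omega)
    have := (hq2 (l - 1) (by omega)).1 this.2
    omega
  refine ⟨l, q - l, N - q, hl1, by omega, ?_⟩
  intro i hi0 hi
  obtain ⟨i, rfl⟩ := Int.eq_ofNat_of_zero_le hi0
  have a1 := hl2 i (by omega)
  have a2 := hq2 i (by omega)
  have := noneg (f0 + i) (by omega) (by omega)
  have := h.e (f0 + i)
  have := h'.e (f0 + i)
  omega

/-- the partner pattern, on the other half circle -/
theorem both (h : Bd n π T) (h' : Bd n π T')
    (hne : ¬ ∀ i, T (π i) - T i = T' (π i) - T' i) :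
    ∃ f0, ∃ l m k : ℕ, 1 ≤ l ∧ π f0 = f0 + n ∧ Pat n π T T' f0 l m k ∧
      Pat n π T' T (f0 + n) l k m := by
  have hn := h.pos
  -- some point of kind (n, 2n)
  obtain ⟨f, hf, hf'⟩ : ∃ f, T (π f) = T f + n ∧ T' (π f) = T' f + 2 * n := by
    push Not at hne
    obtain ⟨i, hi⟩ := hne
    have a1 := h.e_pi i
    have a2 := h'.e_pi i
    rcases h.e i with h1 | h1 <;> rcases h'.e i with h2 | h2
    · omega
    · exact ⟨i, h1, h2⟩
    · exact ⟨π i, by omega, by omega⟩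
    · omega
  -- a leftmost one
  obtain ⟨f0, hf, hf', hp⟩ : ∃ f0, T (π f0) = T f0 + n ∧ T' (π f0) = T' f0 + 2 * n ∧
      ¬ (T (π (f0 - 1)) = T (f0 - 1) + n ∧ T' (π (f0 - 1)) = T' (f0 - 1) + 2 * n) := by
    by_contra hc
    push Not at hc
    have all : ∀ N : ℕ, T (π (f - N)) = T (f - N) + n ∧ T' (π (f - N)) = T' (f - N) + 2 * n := by
      intro N
      induction N with
      | zero => simpa using ⟨hf, hf'⟩
      | succ N ih =>
        have := hc (f - N) ih.1 ih.2
        push_cast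
        rw [show f - ((N : ℤ) + 1) = f - N - 1 by ring]
        exact this
    have a1 := all n.toNat
    rw [show ((n.toNat : ℕ) : ℤ) = n by omega] at a1
    have a2 := h.diam h' a1.1 a1.2
    have a3 := h.e_pi (f - n)
    rw [a2, sub_add_cancel] at a3 a1
    omega
  have hd := h.diam h' hf hf'
  obtain ⟨l, m, k, hl, hP⟩ := h.sign h' hf hf' hp
  have a1 := h.e_pi f0
  have a2 := h'.e_pi f0
  rw [hd] at a1 a2 hf hf'
  have hlast := hP.2 (n - 1) (by omega) (by omega)
  rw [show f0 + (n - 1) = f0 + n - 1 by ring] at hlast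
  obtain ⟨l', m', k', hl', hP'⟩ := h'.sign h (f0 := f0 + n) (by omega) (by omega) (by omega)
  have hll : l = l' := by
    have x1 := hP.1
    have x2 := hP'.1
    apply le_antisymm
    · by_contra hc
      have y1 := hP.2 l' (by omega) (by omega)
      have y2 := hP'.2 l' (by omega) (by omega)
      have y3 := h.diam h' (f := f0 + l') (by omega) (by omega)
      have e1 := h.e_pi (f0 + l')
      have e2 := h'.e_pi (f0 + l')
      rw [y3, show f0 + l' + n = f0 + n + l' by ring] at e1 e2 y1
      omega
    · by_contra hc
      have y1 := hP.2 l (by omega) (by omega)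
      have y2 := hP'.2 l (by omega) (by omega)
      have y3 := h'.diam h (f := f0 + n + l) (by omega) (by omega)
      have e1 := h.e_pi (f0 + n + l)
      have e2 := h'.e_pi (f0 + n + l)
      rw [y3, show f0 + n + l + n = f0 + l + 2 * n by ring] at e1 e2 y2
      rw [h.per, h.pper, h.per] at e1
      rw [h'.per, h'.pper, h'.per] at e2
      rw [h'.per, h.per] at y2
      omega
  subst hll
  have half : ∀ i, 0 < i → i < n → f0 + n < π (f0 + i) ∧ π (f0 + i) < f0 + 2 * n := by
    intro i h1 h2
    have := h.cross1 (f := f0) (i := f0 + i) (by rw [hd]; omega) (by omega) (by omega)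
    omega
  have hk : k ≤ m' := by
    have h1 : (Finset.Ico (f0 + l + m) (f0 + n)).card ≤
        (Finset.Ico (f0 + n + l) (f0 + n + l + m')).card := by
      apply Finset.card_le_card_of_injOn π
      · intro i hi
        simp only [Finset.coe_Ico, Set.mem_Ico] at hi ⊢
        have b1 := half (i - f0) (by omega) (by omega)
        have b2 := hP.2 (i - f0) (by omega) (by omega)
        rw [show f0 + (i - f0) = i by ring] at b1 b2
        have b3 := hP'.2 (π i - (f0 + n)) (by omega) (by omega)
        rw [show f0 + n + (π i - (f0 + n)) = π i by ring] at b3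
        have e1 := h.e_pi i
        have e2 := h'.e_pi i
        omega
      · intro i _ j _ hij
        exact h.inj hij
    simp only [Int.card_Ico] at h1
    have x1 := hP.1
    omega
  have hm : m ≤ k' := by
    have x2 := hP'.1
    have x1 := hP.1
    have h1 : (Finset.Ico (f0 + l) (f0 + l + m)).card ≤
        (Finset.Ico (f0 + n + l + m') (f0 + n + n)).card := by
      apply Finset.card_le_card_of_injOn π
      · intro i hi
        simp only [Finset.coe_Ico, Set.mem_Ico] at hi ⊢
        have b1 := half (i - f0) (by omega) (by omega)
        have b2 := hP.2 (i - f0) (by omega) (by omega)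
        rw [show f0 + (i - f0) = i by ring] at b1 b2
        have b3 := hP'.2 (π i - (f0 + n)) (by omega) (by omega)
        rw [show f0 + n + (π i - (f0 + n)) = π i by ring] at b3
        have e1 := h.e_pi i
        have e2 := h'.e_pi i
        omega
      · intro i _ j _ hij
        exact h.inj hij
    simp only [Int.card_Ico] at h1
    omega
  have x1 := hP.1
  have x2 := hP'.1
  obtain rfl : k = m' := by omega
  obtain rfl : m = k' := by omega
  exact ⟨f0, l, m, k, hl, hd, hP, hP'⟩

/-- consequence of a pattern for the range of `T` -/
theorem model (h : Bd n π T) {f0 : ℤ} {l m k : ℕ} (hl : 1 ≤ l) (hd : π f0 = f0 + n)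
    (hP : Pat n π T T' f0 l m k) (t : ℤ) (h0 : 0 ≤ t) (h1 : t < n) :
    (∃ i, T i = T f0 + t) ∧ ((∃ i, T i = T f0 + t + n) ↔ ¬ (l ≤ t ∧ t < l + m)) ∧
    ((∃ i, T i = T f0 + t + 2 * n) ↔ (l ≤ t ∧ t < l + m)) := by
  have hn := h.pos
  have hs : T (f0 + n) = T f0 + n := by
    have := hP.2 0 (by omega) (by omega)
    rw [add_zero, hd] at this
    omega
  have hT : ∀ t, 0 ≤ t → t ≤ n → T (f0 + t) = T f0 + t := by
    have lb : ∀ (N : ℕ) x, T x + N ≤ T (x + N) := by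
      intro N
      induction N with
      | zero => simp
      | succ N ih =>
        intro x
        have := ih x
        have h2 := h.mono (show x + N < x + (N + 1 : ℕ) by push_cast; omega)
        push_cast at h2 ⊢
        omega
    intro t h0 h1
    have a1 := lb t.toNat f0
    have a2 := lb (n - t).toNat (f0 + t)
    rw [show ((t.toNat : ℕ) : ℤ) = t by omega] at a1
    rw [show (((n - t).toNat : ℕ) : ℤ) = n - t by omega,
      show f0 + t + (n - t) = f0 + n by ring] at a2
    omega
  have hTt := hT t h0 (by omega)
  refine ⟨⟨f0 + t, hTt⟩, ?_⟩
  have p := hP.2 t h0 h1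
  rw [hTt] at p
  have ex1 := fun i (hi : T i = T f0 + t + n) => h.exc (f0 + t) i (by rw [hTt]; omega)
  have ex2 := fun i (hi : T i = T f0 + t + 2 * n) => h.exc (f0 + t) i (by rw [hTt]; omega)
  constructor
  · constructor
    · rintro ⟨i, hi⟩
      have := ex1 i hi
      subst this
      omega
    · intro hc
      exact ⟨π (f0 + t), by omega⟩
  · constructor
    · rintro ⟨i, hi⟩
      have := ex2 i hi
      subst this
      omega
    · intro hc
      exact ⟨π (f0 + t), by omega⟩

end Bd

namespace ThreeBraid

/-- The point at time `t` (on the universal cover) is an endpoint of a chord. -/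
def PW (V : List (ℕ × ℕ)) (t : ℤ) : Prop :=
  ((V.getD (t % V.length).toNat (0, 0)).1 : ℤ) = (t / V.length) % 3 + 1 ∨
  ((V.getD (t % V.length).toNat (0, 0)).2 : ℤ) = (t / V.length) % 3 + 1

theorem PW_eq (V : List (ℕ × ℕ)) (r : ℕ) (q : ℤ) (hr : r < V.length) :
    PW V (r + V.length * q) ↔
      ((V.getD r (0, 0)).1 : ℤ) = q % 3 + 1 ∨ ((V.getD r (0, 0)).2 : ℤ) = q % 3 + 1 := by
  unfold PW
  have h1 : ((r : ℤ) + V.length * q) % V.length = r := by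
    rw [Int.add_mul_emod_self_left]
    exact Int.emod_eq_of_lt (by omega) (by omega)
  have h2 : ((r : ℤ) + V.length * q) / V.length = q := by
    rw [Int.add_mul_ediv_left _ _ (by omega), Int.ediv_eq_zero_of_lt (by omega) (by omega), zero_add]
  rw [h1, h2, Int.toNat_natCast]

theorem decomp (n : ℕ) (hn : 0 < n) (t : ℤ) : ∃ (r : ℕ) (q : ℤ), r < n ∧ t = r + n * q := by
  refine ⟨(t % n).toNat, t / n, ?_, ?_⟩
  · have := Int.emod_lt_of_pos t (show (0 : ℤ) < n by omega)
    have := Int.emod_nonneg t (show (n : ℤ) ≠ 0 by omega)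
    omega
  · have := Int.emod_nonneg t (show (n : ℤ) ≠ 0 by omega)
    have := Int.emod_add_mul_ediv t n
    omega

theorem letter {V : List (ℕ × ℕ)} (hV : IsChordWord 3 V) {r : ℕ} (hr : r < V.length) :
    1 ≤ (V.getD r (0, 0)).1 ∧ (V.getD r (0, 0)).1 < (V.getD r (0, 0)).2 ∧
      (V.getD r (0, 0)).2 ≤ 3 := by
  rw [List.getD_eq_getElem _ _ hr]
  exact hV _ (List.getElem_mem hr)

theorem PW_three (V : List (ℕ × ℕ)) (n : ℕ) (hn : V.length = n) (h0 : 0 < n)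
    (t : ℤ) : ∃ (r : ℕ) (q : ℤ), r < V.length ∧ t = r + n * q ∧
      (∀ c : ℤ, PW V (t + c * n) ↔ 
        ((V.getD r (0, 0)).1 : ℤ) = (q + c) % 3 + 1 ∨
          ((V.getD r (0, 0)).2 : ℤ) = (q + c) % 3 + 1) := by
  subst hn
  obtain ⟨r, q, hr, rfl⟩ := decomp V.length h0 t
  refine ⟨r, q, hr, rfl, fun c => ?_⟩
  rw [← PW_eq V r (q + c) hr]
  rw [show (r : ℤ) + V.length * q + c * V.length = r + V.length * (q + c) by ring]

theorem PW_per (V : List (ℕ × ℕ)) (n : ℕ) (hn : V.length = n) (h0 : 0 < n)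
    (t c : ℤ) : PW V (t + 3 * n * c) ↔ PW V t := by
  obtain ⟨r, q, hr, _, h⟩ := PW_three V n hn h0 t
  have h1 := h (3 * c)
  have h2 := h 0
  rw [show t + 3 * c * n = t + 3 * n * c by ring] at h1
  rw [zero_mul, add_zero, add_zero] at h2
  rw [h1, h2]
  omega

/-- exactly two of three -/
theorem PW_two {V : List (ℕ × ℕ)} (n : ℕ) (hn : V.length = n) (h0 : 0 < n)
    (hV : IsChordWord 3 V) (t : ℤ) :
    (PW V t ∧ PW V (t + n) ∧ ¬ PW V (t + 2 * n)) ∨ (PW V t ∧ ¬ PW V (t + n) ∧ PW V (t + 2 * n)) ∨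
    (¬ PW V t ∧ PW V (t + n) ∧ PW V (t + 2 * n)) := by
  obtain ⟨r, q, hr, _, h⟩ := PW_three V n hn h0 t
  have h1 := h 0
  have h2 := h 1
  have h3 := h 2
  have hl := letter hV hr
  rw [zero_mul, add_zero] at h1
  rw [one_mul] at h2
  rw [h1, h2, h3]
  omega

theorem PW_ext {V W : List (ℕ × ℕ)} (hV : IsChordWord 3 V) (hW : IsChordWord 3 W)
    (hl : V.length = W.length) (h : ∀ t, PW V t ↔ PW W t) : V = W := by
  apply List.ext_getElem hl
  intro r h1 h2
  have a0 := h (r + V.length * 0)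
  have a1 := h (r + V.length * 1)
  have a2 := h (r + V.length * 2)
  rw [PW_eq V _ _ h1, hl, PW_eq W _ _ h2] at a0 a1 a2
  have l1 := letter hV h1
  have l2 := letter hW h2
  rw [List.getD_eq_getElem _ _ h1] at a0 a1 a2 l1
  rw [List.getD_eq_getElem _ _ h2] at a0 a1 a2 l2
  apply Prod.ext <;> omega

theorem cyc_step {V : List (ℕ × ℕ)} (hV : IsChordWord 3 V) (h0 : 0 < V.length) :
    ∃ V1, IsChordWord 3 V1 ∧ V1.length = V.length ∧ CycMove 3 V V1 ∧
      ∀ t, PW V1 (t + 1) ↔ PW V t := by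
  obtain ⟨U, ⟨i, j⟩, rfl⟩ : ∃ U p, V = U ++ [p] :=
    ⟨V.dropLast, V.getLast (by rintro rfl; simp at h0), (List.dropLast_append_getLast _).symm⟩
  have hij := hV (i, j) (by simp)
  simp only at hij
  have hU : IsChordWord 3 U := fun p hp => hV p (by simp [hp])
  have key : ∀ i' j' : ℕ, (1 ≤ i' ∧ i' < j' ∧ j' ≤ 3) →
      (∀ q : ℤ, ((i' : ℤ) = (q + 1) % 3 + 1 ∨ (j' : ℤ) = (q + 1) % 3 + 1) ↔
        ((i : ℤ) = q % 3 + 1 ∨ (j : ℤ) = q % 3 + 1)) →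
      IsChordWord 3 ((i', j') :: U) ∧ ((i', j') :: U).length = (U ++ [(i, j)]).length ∧
        ∀ t, PW ((i', j') :: U) (t + 1) ↔ PW (U ++ [(i, j)]) t := by
    intro i' j' hb hq
    refine ⟨?_, by simp, ?_⟩
    · intro p hp
      rcases List.mem_cons.1 hp with rfl | hp
      · exact hb
      · exact hU p hp
    · intro t
      obtain ⟨r, q, hr, rfl⟩ := decomp _ h0 t
      rw [PW_eq _ _ _ hr]
      have hlen : (U ++ [(i, j)]).length = ((i', j') :: U).length := by simp
      simp only [List.length_append, List.length_singleton] at hr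
      by_cases hc : r = U.length
      · subst hc
        have := PW_eq ((i', j') :: U) 0 (q + 1) (by simp)
        rw [show ((U.length : ℤ) + ((U ++ [(i, j)]).length : ℤ) * q + 1) =
          ((0 : ℕ) : ℤ) + (((i', j') :: U).length : ℤ) * (q + 1) by simp; ring, this]
        simpa using hq q
      · have := PW_eq ((i', j') :: U) (r + 1) q (by simp; omega)
        rw [hlen, show ((r : ℤ) + (((i', j') :: U).length : ℤ) * q + 1) =
          ((r + 1 : ℕ) : ℤ) + (((i', j') :: U).length : ℤ) * q by push_cast; ring, this]
        rw [List.getD_cons_succ, List.getD_append _ _ _ _ (by omega)]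
  by_cases hj : j < 3
  · have := key (i + 1) (j + 1) (by omega) (by intro q; omega)
    exact ⟨_, this.1, this.2.1, Or.inl ⟨U, i, j, hj, rfl, rfl⟩, this.2.2⟩
  · have := key 1 (i + 1) (by omega) (by intro q; omega)
    obtain rfl : j = 3 := by omega
    exact ⟨_, this.1, this.2.1, Or.inr ⟨U, i, rfl, rfl⟩, this.2.2⟩

theorem cyc_symm {V W : List (ℕ × ℕ)} (h : CycEquiv 3 V W) : CycEquiv 3 W V := by
  unfold CycEquiv at *
  induction h with
  | refl => exact Relation.ReflTransGen.refl
  | tail _ h ih => exact Relation.ReflTransGen.head h.symm ih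

theorem cyc_trans {U V W : List (ℕ × ℕ)} (h : CycEquiv 3 U V) (h' : CycEquiv 3 V W) :
    CycEquiv 3 U W := Relation.ReflTransGen.trans h h'

theorem cyc_steps {V : List (ℕ × ℕ)} (hV : IsChordWord 3 V) (h0 : 0 < V.length) (s : ℕ) :
    ∃ V1, IsChordWord 3 V1 ∧ V1.length = V.length ∧ CycEquiv 3 V V1 ∧
      ∀ t, PW V1 (t + s) ↔ PW V t := by
  induction s with
  | zero => exact ⟨V, hV, rfl, Relation.ReflTransGen.refl, by simp⟩
  | succ s ih =>
    obtain ⟨V1, a, b, c, d⟩ := ih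
    obtain ⟨V2, a2, b2, c2, d2⟩ := cyc_step a (by omega)
    refine ⟨V2, a2, by omega, Relation.ReflTransGen.tail c (Or.inl c2), fun t => ?_⟩
    rw [← d t, ← d2 (t + s)]
    push_cast
    rw [add_assoc]

theorem cyc_of_shift {V W : List (ℕ × ℕ)} (hV : IsChordWord 3 V) (hW : IsChordWord 3 W)
    (hl : W.length = V.length) (h0 : 0 < V.length) (s : ℤ) (h : ∀ t, PW W (t + s) ↔ PW V t) :
    CycEquiv 3 V W := by
  obtain ⟨V1, a, b, c, d⟩ := cyc_steps hV h0 (s + 3 * V.length * |s|).toNat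
  have hs : 0 ≤ s + 3 * V.length * |s| := by
    have : -|s| ≤ s := neg_abs_le s
    have : 0 ≤ |s| := abs_nonneg s
    have : (1 : ℤ) ≤ V.length := by omega
    nlinarith
  have : V1 = W := by
    apply PW_ext a hW (by omega)
    intro t
    have h1 := d (t - s - 3 * V.length * |s|)
    rw [Int.toNat_of_nonneg hs] at h1
    have h2 := h (t - s - 3 * V.length * |s|)
    have h3 := PW_per W V.length hl h0 t (-|s|)
    rw [show t - s - 3 * V.length * |s| + (s + 3 * V.length * |s|) = t by ring] at h1
    rw [show t - s - 3 * V.length * |s| + s = t + 3 * V.length * (-|s|) by ring] at h2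
    rw [h1, ← h2, h3]
  rw [← this]; exact c

/-- the word `a^l c^m a^k` -/
def mw (l m k : ℕ) : List (ℕ × ℕ) :=
  List.replicate l (1, 2) ++ List.replicate m (1, 3) ++ List.replicate k (1, 2)

theorem mw_chord (l m k : ℕ) : IsChordWord 3 (mw l m k) := by
  intro p hp
  simp only [mw, List.mem_append, List.mem_replicate] at hp
  rcases hp with (⟨_, rfl⟩ | ⟨_, rfl⟩) | ⟨_, rfl⟩ <;> simp

theorem mw_len (l m k : ℕ) : (mw l m k).length = l + m + k := by
  simp [mw]; omega

theorem mw_get (l m k r : ℕ) (hr : r < l + m + k) :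
    (mw l m k).getD r (0, 0) = if l ≤ r ∧ r < l + m then (1, 3) else (1, 2) := by
  rw [List.getD_eq_getElem _ _ (by rw [mw_len]; exact hr)]
  simp only [mw, List.getElem_append, List.getElem_replicate, List.length_append,
    List.length_replicate]
  split_ifs <;> first | rfl | omega

theorem cyc_model {V : List (ℕ × ℕ)} (hV : IsChordWord 3 V) {n l m k : ℕ} (hn : V.length = n)
    (h0 : 0 < n) (hs : l + m + k = n) (τ : ℤ)
    (h : ∀ t : ℤ, 0 ≤ t → t < n → PW V (τ + t) ∧ (PW V (τ + t + n) ↔ ¬ (l ≤ t ∧ t < l + m)) ∧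
      (PW V (τ + t + 2 * n) ↔ (l ≤ t ∧ t < l + m))) : CycEquiv 3 V (mw l m k) := by
  apply cyc_symm
  apply cyc_of_shift (mw_chord l m k) hV (by rw [mw_len]; omega) (by rw [mw_len]; omega) τ
  intro t
  obtain ⟨r, q, hr, ht, h1⟩ := PW_three (mw l m k) n (by rw [mw_len]; omega) h0 t
  have h2 := h1 0
  rw [zero_mul, add_zero, add_zero, mw_get l m k r (by rw [mw_len] at hr; exact hr)] at h2
  rw [mw_len] at hr
  rw [h2]
  obtain ⟨a, b, c⟩ := h r (by omega) (by omega)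
  have hp := PW_per V n hn h0
  have hq : q % 3 = 0 ∨ q % 3 = 1 ∨ q % 3 = 2 := by omega
  have hq2 : q = q % 3 + 3 * (q / 3) := (Int.emod_add_mul_ediv q 3).symm
  rcases hq with hq | hq | hq
  · rw [hq] at hq2 ⊢
    rw [ht, hq2, show (r : ℤ) + n * (0 + 3 * (q / 3)) + τ = τ + r + 3 * n * (q / 3) by ring, hp]
    simp only [a, true_iff]
    left; split_ifs <;> simp
  · rw [hq] at hq2 ⊢
    rw [ht, hq2, show (r : ℤ) + n * (1 + 3 * (q / 3)) + τ = τ + r + n + 3 * n * (q / 3) by ring,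
      hp, b]
    split_ifs <;> simp <;> omega
  · rw [hq] at hq2 ⊢
    rw [ht, hq2, show (r : ℤ) + n * (2 + 3 * (q / 3)) + τ = τ + r + 2 * n + 3 * n * (q / 3) by ring,
      hp, c]
    split_ifs <;> simp <;> omega

theorem mw_zero (l k : ℕ) : CycEquiv 3 (mw l k 0) (mw l 0 k) := by
  have : ∀ k l, CycEquiv 3 (mw l k 0) (List.replicate (l + k) (1, 2)) := by
    intro k
    induction k with
    | zero => intro l; simp [mw]; exact Relation.ReflTransGen.refl
    | succ k ih =>
      intro l
      refine Relation.ReflTransGen.head (Or.inl (Or.inr ⟨mw l k 0, 1, ?_, rfl⟩)) ?_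
      · simp [mw, List.replicate_succ']
      · have := ih (l + 1)
        rw [show l + (k + 1) = l + 1 + k by ring]
        exact this
  have h := this k l
  rw [show mw l 0 k = List.replicate (l + k) (1, 2) by simp [mw]]
  exact h

end ThreeBraid

namespace ThreeBraid

/-- indices of letters of `V` touching strand `s + 1` -/
def FS (V : List (ℕ × ℕ)) (s : ℕ) : List ℕ :=
  (List.range V.length).filter
      (fun r => decide ((V.getD r (0, 0)).1 = s + 1 ∨ (V.getD r (0, 0)).2 = s + 1))

/-- times of all endpoints in one period -/
def LT (V : List (ℕ × ℕ)) : List ℕ :=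
  FS V 0 ++ (FS V 1).map (· + V.length) ++ (FS V 2).map (· + 2 * V.length)

theorem mem_FS {V : List (ℕ × ℕ)} {s r : ℕ} : r ∈ FS V s ↔
    r < V.length ∧ ((V.getD r (0, 0)).1 = s + 1 ∨ (V.getD r (0, 0)).2 = s + 1) := by
  simp only [FS, List.mem_filter, List.mem_range, decide_eq_true_eq]

theorem std_eq (V : List (ℕ × ℕ)) :
    standardName 3 V = (LT V).map (fun t => t % V.length + 1) := by
  have h : standardName 3 V = (FS V 0).map (· + 1) ++ (FS V 1).map (· + 1) ++ (FS V 2).map (· + 1) := by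
    simp [standardName, FS, List.range_succ, List.flatMap_append]
  rw [h, LT, List.map_append, List.map_append, List.map_map, List.map_map]
  congr 1
  · congr 1
    · apply List.map_congr_left
      intro r hr
      rw [Nat.mod_eq_of_lt (mem_FS.1 hr).1]
    · apply List.map_congr_left
      intro r hr
      simp only [Function.comp]
      rw [Nat.add_mod_right, Nat.mod_eq_of_lt (mem_FS.1 hr).1]
  · apply List.map_congr_left
    intro r hr
    simp only [Function.comp]
    rw [Nat.add_mul_mod_self_right, Nat.mod_eq_of_lt (mem_FS.1 hr).1]

theorem FS_len (V : List (ℕ × ℕ)) (s : ℕ) :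
    (FS V s).length = V.countP (fun p => decide (p.1 = s + 1 ∨ p.2 = s + 1)) := by
  have h : V = (List.range V.length).map (fun r => V.getD r (0, 0)) := by
    apply List.ext_getElem (by simp)
    intro i h1 h2
    simp [List.getElem_map, List.getElem?_eq_getElem h1]
  conv_rhs => rw [h]
  rw [List.countP_map, List.countP_eq_length_filter]
  rfl

theorem LT_len {V : List (ℕ × ℕ)} (hV : IsChordWord 3 V) : (LT V).length = 2 * V.length := by
  simp only [LT, List.length_append, List.length_map, FS_len]
  induction V with
  | nil => rfl
  | cons p V ih =>
    have hp := hV p (by simp)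
    have := ih (fun q hq => hV q (by simp [hq]))
    simp only [List.countP_cons, List.length_cons, decide_eq_true_eq] at this ⊢
    split_ifs <;> omega

theorem FS_sorted (V : List (ℕ × ℕ)) (s : ℕ) : (FS V s).Pairwise (· < ·) :=
  List.Pairwise.filter _ List.pairwise_lt_range

theorem LT_sorted (V : List (ℕ × ℕ)) : (LT V).Pairwise (· < ·) := by
  rw [LT, List.pairwise_append, List.pairwise_append]
  refine ⟨⟨FS_sorted V 0, ?_, ?_⟩, ?_, ?_⟩
  · rw [List.pairwise_map]
    exact (FS_sorted V 1).imp (by intro a b h; omega)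
  · intro a ha b hb
    obtain ⟨c, _, rfl⟩ := List.mem_map.1 hb
    have := (mem_FS.1 ha).1
    omega
  · rw [List.pairwise_map]
    exact (FS_sorted V 2).imp (by intro a b h; omega)
  · intro a ha b hb
    obtain ⟨c, _, rfl⟩ := List.mem_map.1 hb
    rcases List.mem_append.1 ha with ha | ha
    · have := (mem_FS.1 ha).1
      omega
    · obtain ⟨d, hd, rfl⟩ := List.mem_map.1 ha
      have := (mem_FS.1 hd).1
      omega

theorem mem_LT {V : List (ℕ × ℕ)} {t : ℕ} : t ∈ LT V ↔ t < 3 * V.length ∧ PW V t := by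
  have e : ∀ (r s : ℕ), s < 3 → r < V.length → (PW V ((r : ℤ) + V.length * s) ↔ r ∈ FS V s) := by
    intro r s hs hr
    rw [PW_eq V r s hr, mem_FS]
    constructor
    · intro h; refine ⟨hr, by omega⟩
    · intro h; omega
  simp only [LT, List.mem_append, List.mem_map]
  constructor
  · rintro ((h | ⟨r, h, rfl⟩) | ⟨r, h, rfl⟩)
    · have hr := (mem_FS.1 h).1
      have := (e t 0 (by omega) hr).2 h
      exact ⟨by omega, by simpa using this⟩
    · have hr := (mem_FS.1 h).1
      have := (e r 1 (by omega) hr).2 h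
      exact ⟨by omega, by simpa using this⟩
    · have hr := (mem_FS.1 h).1
      have := (e r 2 (by omega) hr).2 h
      refine ⟨by omega, ?_⟩
      push_cast at this ⊢
      rwa [mul_comm]
  · rintro ⟨h1, h2⟩
    by_cases c1 : t < V.length
    · left; left
      exact (e t 0 (by omega) c1).1 (by simpa using h2)
    · by_cases c2 : t < 2 * V.length
      · left; right
        refine ⟨t - V.length, (e _ 1 (by omega) (by omega)).1 ?_, by omega⟩
        convert h2 using 1
        push_cast
        omega
      · right
        refine ⟨t - 2 * V.length, (e _ 2 (by omega) (by omega)).1 ?_, by omega⟩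
        convert h2 using 1
        push_cast
        omega

/-- Periodic enumeration of a sorted list. -/
theorem enum (L : List ℕ) (n : ℕ) (h0 : 0 < n) (hL : L.length = 2 * n) (hs : L.Pairwise (· < ·))
    (hb : ∀ t ∈ L, t < 3 * n) : ∃ T : ℤ → ℤ, StrictMono T ∧
      (∀ (r : ℕ) (q : ℤ), r < 2 * n → T (r + 2 * n * q) = L.getD r 0 + 3 * n * q) := by
  let T : ℤ → ℤ := fun i =>
    (L.getD (i % (2 * n : ℕ)).toNat 0 : ℤ) + 3 * n * (i / (2 * n : ℕ))
  have hT : ∀ (r : ℕ) (q : ℤ), r < 2 * n → T (r + 2 * n * q) = L.getD r 0 + 3 * n * q := by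
    intro r q hr
    have h1 : ((r : ℤ) + 2 * n * q) % (2 * n : ℕ) = r := by
      push_cast
      rw [Int.add_mul_emod_self_left]
      exact Int.emod_eq_of_lt (by omega) (by omega)
    have h2 : ((r : ℤ) + 2 * n * q) / (2 * n : ℕ) = q := by
      push_cast
      rw [Int.add_mul_ediv_left _ _ (by omega), Int.ediv_eq_zero_of_lt (by omega) (by omega),
        zero_add]
    simp only [T]
    rw [h1, h2, Int.toNat_natCast]
  refine ⟨T, strictMono_int_of_lt_succ ?_, hT⟩
  intro i
  obtain ⟨r, q, hr, rfl⟩ := decomp (2 * n) (by omega) i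
  push_cast
  rw [hT r q hr]
  by_cases hc : r + 1 < 2 * n
  · rw [show (r : ℤ) + 2 * n * q + 1 = ((r + 1 : ℕ) : ℤ) + 2 * n * q by push_cast; ring, hT _ q hc]
    rw [List.getD_eq_getElem _ _ (by omega), List.getD_eq_getElem _ _ (by omega)]
    have := List.pairwise_iff_getElem.1 hs r (r + 1) (by omega) (by omega) (by omega)
    omega
  · rw [show (r : ℤ) + 2 * n * q + 1 = ((0 : ℕ) : ℤ) + 2 * n * (q + 1) by
      have : (r : ℤ) = 2 * n - 1 := by omega
      rw [this]; push_cast; ring, hT _ _ (by omega)]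
    rw [List.getD_eq_getElem _ _ (by omega)]
    have := hb _ (List.getElem_mem (show r < L.length by omega))
    have e : (3 * n * (q + 1) : ℤ) = 3 * n * q + 3 * n := by ring
    rw [e]
    omega

/-- the label at the cyclic position `i` -/
def dz (n : ℕ) (D : List ℕ) (i : ℤ) : ℕ := D.getD (i % (2 * n : ℕ)).toNat 0

theorem len_eq {nD : ℕ} {D : List ℕ} (hD : IsName nD D) {V : List (ℕ × ℕ)}
    (hV : IsBraiding nD 3 V D) : V.length = nD := by
  obtain ⟨hc, k, σ, _, rfl⟩ := hV
  have := hD.1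
  rw [List.length_map, List.length_rotate, std_eq, List.length_map, LT_len hc] at this
  omega

theorem time {nD : ℕ} {D : List ℕ} (hD : IsName nD D) {V : List (ℕ × ℕ)} (h0 : 0 < nD)
    (hV : IsBraiding nD 3 V D) : ∃ T : ℤ → ℤ, StrictMono T ∧
      (∀ i, T (i + 2 * nD) = T i + 3 * nD) ∧
      (∀ i j, (nD : ℤ) ∣ T i - T j ↔ dz nD D i = dz nD D j) ∧
      (∀ t, PW V t ↔ ∃ i, T i = t) := by
  have hn := len_eq hD hV
  obtain ⟨hc, k, σ, _, hDe⟩ := hV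
  have hL := LT_len hc
  obtain ⟨T, hm, hT⟩ := enum (LT V) nD h0 (by omega) (LT_sorted V)
    (fun t ht => by have := (mem_LT.1 ht).1; omega)
  have hper : ∀ i q, T (i + 2 * nD * q) = T i + 3 * nD * q := by
    intro i q
    obtain ⟨r, p, hr, rfl⟩ := decomp (2 * nD) (by omega) i
    push_cast
    rw [show (r : ℤ) + 2 * nD * p + 2 * nD * q = r + 2 * nD * (p + q) by ring, hT _ _ hr, hT _ _ hr]
    ring
  refine ⟨fun i => T (i + k), fun i j h => hm (by omega), ?_, ?_, ?_⟩
  · intro i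
    have := hper (i + k) 1
    simp only
    rw [show i + 2 * nD + (k : ℤ) = i + k + 2 * nD * 1 by ring, this]; ring
  · have key : ∀ i, dz nD D i = σ ((T (i + k) % nD).toNat + 1) := by
      intro i
      obtain ⟨r, q, hr, rfl⟩ := decomp (2 * nD) (by omega) i
      have h1 : ((r : ℤ) + (2 * nD : ℕ) * q) % (2 * nD : ℕ) = r := by
        rw [Int.add_mul_emod_self_left]
        exact Int.emod_eq_of_lt (by omega) (by omega)
      have hlen : ((standardName 3 V).rotate k).length = 2 * nD := by
        rw [List.length_rotate, std_eq, List.length_map]; omega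
      have h2 : dz nD D ((r : ℤ) + (2 * nD : ℕ) * q) = 
          σ ((LT V).getD ((r + k) % (2 * nD)) 0 % nD + 1) := by
        unfold dz
        rw [h1, Int.toNat_natCast]
        subst hDe
        have hlt : (r + k) % (2 * nD) < (LT V).length := by
          rw [hL, hn]; exact Nat.mod_lt _ (by omega)
        rw [List.getD_eq_getElem _ _ (by rw [List.length_map]; omega), List.getElem_map,
          List.getElem_rotate, List.getD_eq_getElem _ _ hlt]
        simp only [std_eq, List.getElem_map, List.length_map, hL, hn]
      rw [h2]
      have h3 : (r : ℤ) + (2 * nD : ℕ) * q + k =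
          ((r + k) % (2 * nD) : ℕ) + 2 * nD * (q + ((r + k) / (2 * nD) : ℕ)) := by
        have := Nat.mod_add_div (r + k) (2 * nD)
        have h4 : ((r + k : ℕ) : ℤ) = (((r + k) % (2 * nD) + 2 * nD * ((r + k) / (2 * nD)) : ℕ) : ℤ) := by
          rw [this]
        push_cast at h4 ⊢
        linarith
      rw [h3, hT _ _ (Nat.mod_lt _ (by omega))]
      rw [show ∀ x y : ℤ, x + 3 * nD * y = x + nD * (3 * y) by intros; ring,
        Int.add_mul_emod_self_left]
      norm_cast
    intro i j
    simp only
    rw [key, key, σ.injective.eq_iff]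
    have a1 := Int.emod_nonneg (T (i + k)) (show (nD : ℤ) ≠ 0 by omega)
    have a2 := Int.emod_nonneg (T (j + k)) (show (nD : ℤ) ≠ 0 by omega)
    rw [← Int.emod_eq_emod_iff_emod_sub_eq_zero.trans Int.dvd_iff_emod_eq_zero.symm]
    omega
  · intro t
    obtain ⟨r, q, hr, rfl⟩ := decomp (3 * nD) (by omega) t
    push_cast
    rw [PW_per V nD hn h0]
    have e1 : PW V r ↔ r ∈ LT V := by
      rw [mem_LT, hn]; exact ⟨fun h => ⟨hr, h⟩, fun h => h.2⟩
    rw [e1]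
    constructor
    · intro h
      obtain ⟨x, hx, hx2⟩ := List.getElem_of_mem h
      refine ⟨x + 2 * nD * q - k, ?_⟩
      rw [sub_add_cancel, hT _ _ (by omega), List.getD_eq_getElem _ _ hx, hx2]
    · rintro ⟨i, hi⟩
      obtain ⟨x, p, hx, hxp⟩ := decomp (2 * nD) (by omega) (i + k)
      rw [hxp] at hi
      push_cast at hi
      rw [hT _ _ hx, List.getD_eq_getElem _ _ (by omega)] at hi
      have hm := List.getElem_mem (show x < (LT V).length by omega)
      have hlt := (mem_LT.1 hm).1
      generalize (LT V)[x]'(by omega) = y at *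
      have : p = q := by
        have b1 : (3 * nD : ℤ) * (p - q) < 3 * nD * 1 := by
          have : (r : ℤ) < 3 * nD := by omega
          rw [mul_sub]; omega
        have b2 : (3 * nD : ℤ) * (q - p) < 3 * nD * 1 := by
          have : (y : ℤ) < 3 * nD := by omega
          rw [mul_sub]; omega
        have c1 := lt_of_mul_lt_mul_left b1 (by omega)
        have c2 := lt_of_mul_lt_mul_left b2 (by omega)
        omega
      subst this
      have : y = r := by omega
      rw [← this]; exact hm

theorem mult {n d : ℤ} (hn : 0 < n) (hd : n ∣ d) (h1 : 0 < d) (h2 : d < 3 * n) :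
    d = n ∨ d = 2 * n := by
  obtain ⟨c, rfl⟩ := hd
  have c1 : 0 < c := by
    by_contra hc
    nlinarith
  have c2 : c < 3 := by
    by_contra hc
    nlinarith
  have : c = 1 ∨ c = 2 := by omega
  rcases this with rfl | rfl
  · left; ring
  · right; ring

end ThreeBraid

namespace ThreeBraid

theorem mkBd {n : ℕ} (h0 : 0 < n) {V : List (ℕ × ℕ)} (hV : IsChordWord 3 V) (hn : V.length = n)
    {d : ℤ → ℕ} {π T : ℤ → ℤ} (hm : StrictMono T) (hper : ∀ i, T (i + 2 * n) = T i + 3 * n)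
    (hd : ∀ i j, (n : ℤ) ∣ T i - T j ↔ d i = d j) (hP : ∀ t, PW V t ↔ ∃ i, T i = t)
    (h1 : ∀ i, i < π i) (h2 : ∀ i, π i < i + 2 * n) (h3 : ∀ i, d (π i) = d i) :
    Bd n π T := by
  have hpos : (0 : ℤ) < n := by omega
  have two := fun i => PW_two n hn h0 hV (T i)
  have mem : ∀ i, PW V (T i) := fun i => (hP _).2 ⟨i, rfl⟩
  have e : ∀ i, T (π i) = T i + n ∨ T (π i) = T i + 2 * n := by
    intro i
    have a1 := hm (h1 i)
    have a2 := hm (h2 i)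
    rw [hper] at a2
    have := mult hpos ((hd (π i) i).2 (h3 i)) (by omega) (by omega)
    omega
  have no : ∀ i j k, T j = T i + n → T k = T i + 2 * n → False := by
    intro i j k hj hk
    have a := two i
    have b := mem i
    have c := mem j
    have d := mem k
    rw [hj] at c
    rw [hk] at d
    tauto
  refine ⟨hpos, hm, hper, e, ?_, ?_, ?_⟩
  · intro i
    apply hm.injective
    rw [hper]
    rcases e i with a | a <;> rcases e (π i) with b | b
    · exact (no i (π i) (π (π i)) a (by omega)).elim
    · omega
    · omega
    · have := hper (π (π i) - 2 * n)
      rw [sub_add_cancel] at this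
      exact (no i (π (π i) - 2 * n) (π i) (by omega) a).elim
  · intro i j hj
    apply hm.injective
    rcases e i with a | a <;> rcases hj with b | b
    · omega
    · exact (no i _ _ a b).elim
    · exact (no i _ _ b a).elim
    · omega
  · intro t
    have := PW_two n hn h0 hV t
    rw [← hP, ← hP, ← hP]
    tauto

theorem exPi {n : ℕ} (h0 : 0 < n) {V : List (ℕ × ℕ)} (hV : IsChordWord 3 V) (hn : V.length = n)
    {d : ℤ → ℕ} {T : ℤ → ℤ} (hm : StrictMono T) (hper : ∀ i, T (i + 2 * n) = T i + 3 * n)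
    (hd : ∀ i j, (n : ℤ) ∣ T i - T j ↔ d i = d j) (hP : ∀ t, PW V t ↔ ∃ i, T i = t) :
    ∃ π : ℤ → ℤ, (∀ i, i < π i) ∧ (∀ i, π i < i + 2 * n) ∧ (∀ i, d (π i) = d i) := by
  have hex : ∀ i, ∃ j, T j = T i + n ∨ T j = T i + 2 * n := by
    intro i
    have a := PW_two n hn h0 hV (T i)
    have b : PW V (T i) := (hP _).2 ⟨i, rfl⟩
    by_cases c : PW V (T i + n)
    · obtain ⟨j, hj⟩ := (hP _).1 c
      exact ⟨j, Or.inl hj⟩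
    · have c2 : PW V (T i + 2 * n) := by
        rcases a with a | a | a
        · exact absurd a.2.1 c
        · exact a.2.2
        · exact a.2.2
      obtain ⟨j, hj⟩ := (hP _).1 c2
      exact ⟨j, Or.inr hj⟩
  choose π hπ using hex
  refine ⟨π, fun i => ?_, fun i => ?_, fun i => ?_⟩
  · rw [← hm.lt_iff_lt]; have := hπ i; omega
  · rw [← hm.lt_iff_lt, hper]; have := hπ i; omega
  · rw [← hd]
    rcases hπ i with h | h
    · exact ⟨1, by rw [h]; ring⟩
    · exact ⟨2, by rw [h]; ring⟩

theorem pat_cyc {n : ℕ} (h0 : 0 < n) {V : List (ℕ × ℕ)} (hV : IsChordWord 3 V)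
    (hn : V.length = n) {π T T' : ℤ → ℤ} (hP : ∀ t, PW V t ↔ ∃ i, T i = t) (h : Bd n π T)
    {f0 : ℤ} {l m k : ℕ} (hl : 1 ≤ l) (hd : π f0 = f0 + n) (hp : Bd.Pat n π T T' f0 l m k) :
    CycEquiv 3 V (mw l m k) := by
  refine cyc_model hV hn h0 (by have := hp.1; omega) (T f0) ?_
  intro t ht0 ht1
  rw [hP, hP, hP]
  exact h.model hl hd hp t ht0 ht1

end ThreeBraid

/-- Two chord words on 3 strands which are braidings of the same
diagram `D` are either cyclically equivalent, or (for some `l, m, n ≥ 1`) one is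
cyclically equivalent to `a^l c^m a^n` and the other to `a^l c^n a^m`, where
`a = A(1,2)` and `c = A(1,3)`. -/
theorem threeBraid_representatives (nD : ℕ) (D : List ℕ) (hD : IsName nD D)
    (V W : List (ℕ × ℕ)) (hV : IsBraiding nD 3 V D) (hW : IsBraiding nD 3 W D) :
    CycEquiv 3 V W ∨
      ∃ l m n : ℕ, 1 ≤ l ∧ 1 ≤ m ∧ 1 ≤ n ∧
        ((CycEquiv 3 V
            (List.replicate l (1, 2) ++ List.replicate m (1, 3) ++
              List.replicate n (1, 2)) ∧
          CycEquiv 3 W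
            (List.replicate l (1, 2) ++ List.replicate n (1, 3) ++
              List.replicate m (1, 2))) ∨
         (CycEquiv 3 W
            (List.replicate l (1, 2) ++ List.replicate m (1, 3) ++
              List.replicate n (1, 2)) ∧
          CycEquiv 3 V
            (List.replicate l (1, 2) ++ List.replicate n (1, 3) ++
              List.replicate m (1, 2)))) := by
  have lV := ThreeBraid.len_eq hD hV
  have lW := ThreeBraid.len_eq hD hW
  rcases Nat.eq_zero_or_pos nD with hz | h0
  · left
    rw [hz] at lV lW
    rw [List.length_eq_zero_iff.1 lV, List.length_eq_zero_iff.1 lW]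
    exact Relation.ReflTransGen.refl
  obtain ⟨T, m1, p1, d1, r1⟩ := ThreeBraid.time hD h0 hV
  obtain ⟨T', m2, p2, d2, r2⟩ := ThreeBraid.time hD h0 hW
  obtain ⟨π, a1, a2, a3⟩ := ThreeBraid.exPi h0 hV.1 lV m1 p1 d1 r1
  have B := ThreeBraid.mkBd h0 hV.1 lV m1 p1 d1 r1 a1 a2 a3
  have B' := ThreeBraid.mkBd h0 hW.1 lW m2 p2 d2 r2 a1 a2 a3
  by_cases hs : ∀ i, T (π i) - T i = T' (π i) - T' i
  · left
    obtain ⟨s, hs⟩ := B.same B' hs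
    refine ThreeBraid.cyc_of_shift hV.1 hW.1 (by omega) (by omega) s ?_
    intro t
    rw [r1, r2]
    constructor
    · rintro ⟨i, hi⟩
      exact ⟨i, by have := hs i; omega⟩
    · rintro ⟨i, hi⟩
      exact ⟨i, by have := hs i; omega⟩
  · obtain ⟨f0, l, m, k, hl, hd, P, P'⟩ := B.both B' hs
    have cV := ThreeBraid.pat_cyc h0 hV.1 lV r1 B hl hd P
    have cW := ThreeBraid.pat_cyc h0 hW.1 lW r2 B' hl (by rw [← hd, B.pp, hd]; ring) P'
    rcases Nat.eq_zero_or_pos m with hm | hm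
    · subst hm
      left
      exact ThreeBraid.cyc_trans cV (ThreeBraid.cyc_trans (ThreeBraid.cyc_symm (ThreeBraid.mw_zero l k)) (ThreeBraid.cyc_symm cW))
    rcases Nat.eq_zero_or_pos k with hk | hk
    · subst hk
      left
      exact ThreeBraid.cyc_trans cV (ThreeBraid.cyc_trans (ThreeBraid.mw_zero l m) (ThreeBraid.cyc_symm cW))
    right
    exact ⟨l, m, k, hl, hm, hk, Or.inl ⟨cV, cW⟩⟩
end
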